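/- arXiv:1108.5053 — 2 statements merged into one kernel-verified Lean document; each statement's English description precedes it below -/
import Mathlib

section
/- Let σ be a primitive invertible substitution on 𝒜 = {a,b} with det M_σ = 1. Then σ is a selfdual substitution (i.e., σ ~ σ̄ or σ ~ E∘σ̄∘E) if and only if σ has a selfdual hull (i.e., X_σ = X_{σ̄} or X_σ = E(X_{σ̄}), where E acts letterwise on bi-infinite words). -/
open scoped Matrix

/-- The two-letter alphabet `𝒜 = {a, b}`; the letter `a` is `0` and the letter `b` is `1`. -/
abbrev A2 := Fin 2

/-- A substitution on the two-letter alphabet, given by the images of the two letters.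
(The nonerasing condition is stated separately as `TwoSubst.NonErasing`.) -/
abbrev Subst := A2 → List A2

namespace TwoSubst

/-- A substitution is non-erasing if the images of the letters are nonempty words. -/
def NonErasing (σ : Subst) : Prop := ∀ i : A2, σ i ≠ []

/-- The extension of a substitution to finite words (the morphism of the free monoid). -/
def apply (σ : Subst) (w : List A2) : List A2 := w.flatMap σ

/-- The `n`-th power `σ^n` of a substitution (as a substitution). -/
def substPow (σ : Subst) (n : ℕ) : Subst := fun i => (apply σ)^[n] [i]

/-- Composition of substitutions: `(σ ∘ τ)(i) = σ(τ(i))`. -/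
def comp (σ τ : Subst) : Subst := fun i => apply σ (τ i)

/-- The substitution matrix `M_σ`: entry `(i, j)` is the number of occurrences of the
letter `i` in `σ(j)`. -/
def M (σ : Subst) : Matrix (Fin 2) (Fin 2) ℤ := fun i j => ((σ j).count i : ℤ)

/-- A substitution is primitive if some power of its substitution matrix has all
entries positive. -/
def Primitive (σ : Subst) : Prop := ∃ n : ℕ, 0 < n ∧ ∀ i j, 0 < (M σ ^ n) i j

/-- A finite word, regarded as an element of the free group `F₂`. -/
def toFG (w : List A2) : FreeGroup A2 := (w.map FreeGroup.of).prod

/-- The endomorphism of the free group `F₂` induced by a substitution. -/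
def endo (σ : Subst) : Monoid.End (FreeGroup A2) := FreeGroup.lift fun i => toFG (σ i)

/-- A substitution is invertible if its extension to the free group `F₂` is an
automorphism of `F₂`. -/
def IsInvertible (σ : Subst) : Prop := Function.Bijective (endo σ)

/-- Two substitutions are conjugate, `σ ~ ρ`, if `σ = γ_w ∘ ρ` as endomorphisms of `F₂`
for some `w ∈ F₂`, where `γ_w x = w * x * w⁻¹`. -/
def Conj (σ ρ : Subst) : Prop := ∃ w : FreeGroup A2, ∀ x, endo σ x = w * endo ρ x * w⁻¹

/-- `w` is a (finite) factor of the bi-infinite word `u : ℤ → A2`. -/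
def IsFactor (w : List A2) (u : ℤ → A2) : Prop :=
  ∃ k : ℤ, w = (List.range w.length).map fun i => u (k + i)

/-- The hull `X_σ`: the set of bi-infinite words all of whose finite factors appear as
factors of `σ^n(a)` or `σ^n(b)` for some `n ∈ ℕ`. -/
def Hull (σ : Subst) : Set (ℤ → A2) :=
  { u | ∀ w : List A2, IsFactor w u → ∃ (n : ℕ) (x : A2), w <:+: substPow σ n x }

/-- The substitution `E : a ↦ b, b ↦ a`. -/
def Esub : Subst := ![[1], [0]]

/-- The substitution `L : a ↦ a, b ↦ ab`. -/
def Lsub : Subst := ![[0], [0, 1]]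

/-- The composition `L^{a₁} ∘ E ∘ L^{a₂} ∘ E ∘ ⋯ ∘ E ∘ L^{a_m}` encoded by the
nonempty list of exponents `a₁ :: [a₂, …, a_m]`. -/
def chain : ℕ → List ℕ → Subst
  | a, [] => substPow Lsub a
  | a, b :: rest => comp (substPow Lsub a) (comp Esub (chain b rest))

/-- The letter-exchange map `a ↦ b, b ↦ a` on letters. -/
def swapA : A2 → A2 := fun i => if i = 0 then 1 else 0

/-- The substitution matrix with real entries. -/
noncomputable def Mreal (σ : Subst) : Matrix (Fin 2) (Fin 2) ℝ := (M σ).map fun z => (z : ℝ)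

/-- `lam` is the inflation factor (Perron–Frobenius eigenvalue) of `σ`: it is an
eigenvalue of `M_σ` admitting a positive eigenvector. -/
def IsInflation (σ : Subst) (lam : ℝ) : Prop :=
  ∃ v : Fin 2 → ℝ, (∀ i, 0 < v i) ∧ (Mreal σ).mulVec v = lam • v

/-- `α` is the frequency of `σ`: `α ∈ (0,1)` and `(1-α, α)` is an eigenvector of `M_σ`
for an eigenvalue with positive eigenvector (necessarily the Perron-Frobenius
eigenvalue, i.e. the inflation factor, when `σ` is primitive). -/
def IsFreq (σ : Subst) (α : ℝ) : Prop :=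
  0 < α ∧ α < 1 ∧ ∃ lam : ℝ, (Mreal σ).mulVec ![1 - α, α] = lam • ![1 - α, α]

/-- The automorphism `τ_a : a ↦ a⁻¹, b ↦ b` of the free group `F₂`. -/
def tauA : Monoid.End (FreeGroup A2) :=
  FreeGroup.lift fun i : A2 => if i = 0 then (FreeGroup.of (0 : A2))⁻¹ else FreeGroup.of 1

/-- `ρ` is the reciprocal substitution `σ̄ = τ_a ∘ σ⁻¹ ∘ τ_a⁻¹` of `σ`, where
`φ` is the inverse automorphism `σ⁻¹` (note `τ_a⁻¹ = τ_a`). -/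
def IsReciprocal (σ ρ : Subst) (φ : Monoid.End (FreeGroup A2)) : Prop :=
  (∀ x, φ (endo σ x) = x) ∧ (∀ x, endo σ (φ x) = x) ∧
    NonErasing ρ ∧ ∀ x, endo ρ x = tauA (φ (tauA x))

/-- `σ` is a selfdual substitution (relative to its reciprocal `ρ = σ̄`):
`σ ~ σ̄` or `σ ~ E ∘ σ̄ ∘ E`. -/
def SelfDual (σ ρ : Subst) : Prop :=
  Conj σ ρ ∨ Conj σ (comp Esub (comp ρ Esub))

/-! ### Strands and dual maps -/

/-- Integer vectors in the plane. -/
abbrev V2 := Fin 2 → ℤ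

/-- The abelianisation map `A : 𝒜* → ℤ²`, counting occurrences of each letter. -/
def Avec (w : List A2) : V2 := fun i => (w.count i : ℤ)

/-- The space `𝒢` (and its dual `𝒢*`): formal finite real linear combinations of the
basis elements `(W, i)` (resp. `(W, i*)`), `W ∈ ℤ²`, `i ∈ 𝒜`. -/
abbrev Gspace := (V2 × A2) →₀ ℝ

/-- The image of the basis element `(W, i)` under `E₁(σ)`. -/
noncomputable def E1Basis (σ : Subst) (p : V2 × A2) : Gspace :=
  ∑ k ∈ Finset.range (σ p.2).length,
    Finsupp.single ((M σ).mulVec p.1 + Avec ((σ p.2).take k), (σ p.2).getD k p.2) (1 : ℝ)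

/-- The one-dimensional extension `E₁(σ)`, as a linear map on `𝒢`. -/
noncomputable def E1 (σ : Subst) : Gspace →ₗ[ℝ] Gspace :=
  Finsupp.lift Gspace ℝ (V2 × A2) (E1Basis σ)

/-- The image of the basis element `(W, i*)` under the dual map `E₁*(σ)`:
`E₁*(σ)(W, i*) = Σ_{j,k : σ(j)_k = i} (M_σ⁻¹·(W + A(σ(j)_{k+1}⋯σ(j)_{|σ(j)|})), j*)`. -/
noncomputable def E1starBasis (σ : Subst) (p : V2 × A2) : Gspace :=
  ∑ j : A2, ∑ k ∈ Finset.range (σ j).length,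
    if (σ j).getD k j = p.2 then
      Finsupp.single ((M σ)⁻¹.mulVec (p.1 + Avec ((σ j).drop (k + 1))), j) (1 : ℝ)
    else 0

/-- The dual map `E₁*(σ)`, as a linear map on `𝒢*`. -/
noncomputable def E1star (σ : Subst) : Gspace →ₗ[ℝ] Gspace :=
  Finsupp.lift Gspace ℝ (V2 × A2) (E1starBasis σ)

/-- The basis vector `e_a = (1,0)`. -/
def ea : V2 := ![1, 0]

/-- The basis vector `e_b = (0,1)`. -/
def eb : V2 := ![0, 1]

/-- `γ(0), …, γ(n)` is a finite dual strand: each step is `e_a` or `-e_b`. -/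
def IsDualStrand (n : ℕ) (γ : ℕ → V2) : Prop :=
  ∀ k < n, γ (k + 1) - γ k = ea ∨ γ (k + 1) - γ k = -eb

/-- The element of `𝒢*` associated with a finite dual strand `γ(0), …, γ(n)`:
the sum of `(γ(k), b*)` over the `e_a`-steps and `(γ(k+1), a*)` over the `-e_b`-steps
(the letter `a` is `0`, the letter `b` is `1`). -/
noncomputable def strandElem (n : ℕ) (γ : ℕ → V2) : Gspace :=
  ∑ k ∈ Finset.range n,
    if γ (k + 1) - γ k = ea then Finsupp.single (γ k, (1 : A2)) (1 : ℝ)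
    else Finsupp.single (γ (k + 1), (0 : A2)) (1 : ℝ)

/-! ### Endomorphisms of the free group -/

/-- The exponent-sum homomorphism of the generator `i` on `F₂`. -/
def expSum (i : A2) : FreeGroup A2 →* Multiplicative ℤ :=
  FreeGroup.lift fun j : A2 => Multiplicative.ofAdd (if j = i then (1 : ℤ) else 0)

/-- The abelianised matrix of an endomorphism of `F₂`: entry `(i,j)` is the exponent
sum of the generator `i` in the image of the generator `j`. -/
def abelMatrix (σ : Monoid.End (FreeGroup A2)) : Matrix (Fin 2) (Fin 2) ℤ :=
  fun i j => Multiplicative.toAdd (expSum i (σ (FreeGroup.of j)))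

/-- `wprod ρ w k = w · ρ(w) · ρ²(w) ⋯ ρ^{k−1}(w)`. -/
def wprod (ρ : Monoid.End (FreeGroup A2)) (w : FreeGroup A2) : ℕ → FreeGroup A2
  | 0 => 1
  | k + 1 => wprod ρ w k * (ρ ^ k) w

end TwoSubst


namespace TwoSubst
open FreeGroup

def pos (w : List A2) : List (A2 × Bool) := w.map fun i => (i, true)

@[simp] lemma pos_nil : pos [] = [] := rfl
@[simp] lemma pos_append (u v : List A2) : pos (u ++ v) = pos u ++ pos v := by simp [pos]
@[simp] lemma pos_cons (i : A2) (v : List A2) : pos (i :: v) = (i, true) :: pos v := by simp [pos]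
lemma pos_injective : Function.Injective pos :=
  List.map_injective_iff.2 (fun a b h => by simpa using h)

@[simp] lemma toFG_nil : toFG [] = 1 := rfl
@[simp] lemma toFG_cons (i : A2) (w : List A2) : toFG (i :: w) = of i * toFG w := by simp [toFG]
@[simp] lemma toFG_append (u v : List A2) : toFG (u ++ v) = toFG u * toFG v := by simp [toFG]

lemma toFG_eq_mk (w : List A2) : toFG w = mk (pos w) := by
  induction w with
  | nil => rfl
  | cons i w ih => rw [toFG_cons, ih, of, mul_mk]; rfl

lemma isReduced_same (L : List (A2 × Bool)) (b : Bool) (h : ∀ x ∈ L, x.2 = b) : IsReduced L := by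
  induction L with
  | nil => exact IsReduced.nil
  | cons x L ih =>
    cases L with
    | nil => exact IsReduced.singleton
    | cons y L =>
      rw [isReduced_cons_cons]
      refine ⟨fun _ => ?_, ih fun z hz => h z (by simp [hz])⟩
      rw [h x (by simp), h y (by simp)]

lemma mem_pos {w : List A2} {x : A2 × Bool} (h : x ∈ pos w) : x.2 = true := by
  simp only [pos, List.mem_map] at h
  obtain ⟨a, _, rfl⟩ := h; rfl

lemma isReduced_pos (w : List A2) : IsReduced (pos w) :=
  isReduced_same _ true fun _ => mem_pos

lemma toWord_toFG (w : List A2) : (toFG w).toWord = pos w := by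
  rw [toFG_eq_mk, toWord_mk, (isReduced_pos w).reduce_eq]

lemma toFG_injective : Function.Injective toFG := fun u v h => by
  apply pos_injective
  rw [← toWord_toFG, ← toWord_toFG, h]

@[simp] lemma endo_of (σ : Subst) (i : A2) : endo σ (of i) = toFG (σ i) := FreeGroup.lift_apply_of

@[simp] lemma apply_nil (σ : Subst) : apply σ [] = [] := rfl
@[simp] lemma apply_cons (σ : Subst) (i : A2) (w : List A2) : apply σ (i :: w) = σ i ++ apply σ w := by
  simp [apply]
@[simp] lemma apply_append (σ : Subst) (u v : List A2) : apply σ (u ++ v) = apply σ u ++ apply σ v := by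
  simp [apply]

lemma endo_toFG (σ : Subst) (w : List A2) : endo σ (toFG w) = toFG (apply σ w) := by
  induction w with
  | nil => simp
  | cons i w ih => simp [ih]

lemma endo_comp (σ τ : Subst) (x : FreeGroup A2) : endo (comp σ τ) x = endo σ (endo τ x) := by
  have : endo (comp σ τ) = (endo σ).comp (endo τ) := by
    apply FreeGroup.ext_hom; intro i
    change endo (comp σ τ) (of i) = endo σ (endo τ (of i))
    rw [endo_of, endo_of, endo_toFG]; rfl
  rw [this]; rfl

lemma conj_iff (σ ρ : Subst) : Conj σ ρ ↔ ∃ w, ∀ i, toFG (σ i) = w * toFG (ρ i) * w⁻¹ := by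
  constructor
  · rintro ⟨w, h⟩; exact ⟨w, fun i => by simpa using h (of i)⟩
  · rintro ⟨w, h⟩
    refine ⟨w, fun x => ?_⟩
    have : (endo σ : FreeGroup A2 →* FreeGroup A2) = (MulAut.conj w).toMonoidHom.comp (endo ρ) := by
      apply FreeGroup.ext_hom; intro i
      change endo σ (of i) = w * endo ρ (of i) * w⁻¹
      simpa using h i
    rw [this]; rfl

lemma Conj.symm {σ ρ : Subst} (h : Conj σ ρ) : Conj ρ σ := by
  obtain ⟨w, h⟩ := h
  exact ⟨w⁻¹, fun x => by rw [h]; group⟩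

lemma Conj.trans {σ ρ τ : Subst} (h : Conj σ ρ) (h' : Conj ρ τ) : Conj σ τ := by
  obtain ⟨w, h⟩ := h
  obtain ⟨w', h'⟩ := h'
  exact ⟨w * w', fun x => by rw [h, h']; group⟩

lemma Conj.refl (σ : Subst) : Conj σ σ := ⟨1, by simp⟩

lemma expSum_toFG (i : A2) (w : List A2) : Multiplicative.toAdd (expSum i (toFG w)) = (w.count i : ℤ) := by
  induction w with
  | nil => simp
  | cons j w ih =>
    rw [toFG_cons, _root_.map_mul, toAdd_mul, ih]
    by_cases hj : j = i <;> simp [expSum, hj, List.count_cons, add_comm]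

lemma Conj.M_eq {σ ρ : Subst} (h : Conj σ ρ) : M σ = M ρ := by
  obtain ⟨w, h⟩ := (conj_iff _ _).1 h
  ext i j
  simp only [M]
  rw [← expSum_toFG, ← expSum_toFG, h]
  simp

lemma Conj.surj {σ ρ : Subst} (h : Conj σ ρ) (hs : Function.Surjective (endo σ)) :
    Function.Surjective (endo ρ) := by
  obtain ⟨w, h⟩ := h
  intro y
  obtain ⟨x, hx⟩ := hs (w * y * w⁻¹)
  refine ⟨x, ?_⟩
  rw [h] at hx
  simpa using hx

/-! infix lemma -/
lemma toWord_mk_singleton_mul (g : A2 × Bool) (X : FreeGroup A2) :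
    (mk [g] * X).toWord = g :: X.toWord ∨ (mk [g] * X).toWord = X.toWord.tail := by
  conv => enter [1,1]; rw [← mk_toWord (x := X)]
  conv => enter [2,1]; rw [← mk_toWord (x := X)]
  rw [mul_mk, toWord_mk]
  simp only [List.cons_append, List.nil_append, reduce.cons, reduce_toWord]
  rcases X.toWord with _ | ⟨y, L⟩
  · simp
  · simp only
    split_ifs <;> simp

lemma tail_infix {α : Type*} {S L : List α} (h : S <:+: L) : S.tail <:+: L.tail := by
  obtain ⟨p, q, rfl⟩ := h
  cases S with
  | nil => simp
  | cons s S =>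
    cases p with
    | nil => exact ⟨[], q, by simp⟩
    | cons a p => exact ⟨p ++ [s], q, by simp⟩

lemma infix_mk_mul (S : List (A2 × Bool)) (L : List (A2 × Bool)) (X : FreeGroup A2)
    (h : S <:+: X.toWord) : S.drop L.length <:+: (mk L * X).toWord := by
  induction L with
  | nil => simpa [← one_eq_mk] using h
  | cons g L ih =>
    have e : mk (g :: L) * X = mk [g] * (mk L * X) := by
      rw [← mul_assoc, mul_mk]; rfl
    rw [e, List.length_cons, ← List.tail_drop]
    rcases toWord_mk_singleton_mul g (mk L * X) with h1 | h1 <;> rw [h1]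
    · exact (List.tail_suffix _).isInfix.trans (ih.trans (List.suffix_cons _ _).isInfix)
    · exact tail_infix ih

lemma invRev_infix {S L : List (A2 × Bool)} (h : S <:+: L) : invRev S <:+: invRev L := by
  obtain ⟨p, q, rfl⟩ := h
  exact ⟨invRev q, invRev p, by simp⟩

lemma infix_mul (S : List (A2 × Bool)) (w : FreeGroup A2) (X : FreeGroup A2)
    (h : S <:+: X.toWord) : S.drop w.norm <:+: (w * X).toWord := by
  have := infix_mk_mul S w.toWord X h
  rwa [mk_toWord] at this

lemma infix_mul_right (S : List (A2 × Bool)) (w : FreeGroup A2) (X : FreeGroup A2)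
    (h : S <:+: X.toWord) : invRev ((invRev S).drop w.norm) <:+: (X * w).toWord := by
  have h1 : invRev S <:+: (X⁻¹).toWord := by rw [toWord_inv]; exact invRev_infix h
  have := invRev_infix (infix_mul _ w⁻¹ _ h1)
  rwa [← toWord_inv, mul_inv_rev, inv_inv, inv_inv, norm_inv_eq] at this

/-- The middle of a positive word survives conjugation. -/
lemma middle_infix {P l m r : List A2} {w : FreeGroup A2}
    (h : toFG P = w * toFG (l ++ m ++ r) * w⁻¹) (hl : w.norm ≤ l.length) (hr : w.norm ≤ r.length) :
    m <:+: P := by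
  have h0 : pos (l ++ m ++ r) <:+: (toFG (l ++ m ++ r)).toWord := by rw [toWord_toFG]
  have h1 := infix_mul_right _ w⁻¹ _ (infix_mul _ w _ h0)
  rw [← h, toWord_toFG] at h1
  have h2 : pos m <:+: pos P := by
    refine List.IsInfix.trans ?_ h1
    have e1 : (pos (l ++ m ++ r)).drop w.norm = (pos l).drop w.norm ++ pos m ++ pos r := by
      rw [pos_append, pos_append, List.drop_append_of_le_length (by simp [pos]; omega),
        List.drop_append_of_le_length (by simpa [pos])]
    rw [e1, norm_inv_eq, invRev_append, List.drop_append_of_le_length (by simpa [pos]), invRev_append,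
      invRev_append, invRev_append]
    refine ⟨(pos l).drop w.norm, ?_, ?_⟩
    rotate_left
    · simp only [invRev_invRev]; rfl
  obtain ⟨p, q, e⟩ := h2
  have e' := congrArg (List.map Prod.fst) e
  simp only [pos, List.map_append, List.map_map] at e'
  refine ⟨p.map Prod.fst, q.map Prod.fst, ?_⟩
  simpa [Function.comp_def] using e'

end TwoSubst

namespace TwoSubst
open FreeGroup

lemma substPow_zero (σ : Subst) (x : A2) : substPow σ 0 x = [x] := rfl
lemma substPow_succ (σ : Subst) (n : ℕ) (x : A2) :
    substPow σ (n + 1) x = apply σ (substPow σ n x) := by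
  simp only [substPow]; rw [Function.iterate_succ_apply']

lemma iterate_apply_append (σ : Subst) (n : ℕ) (u v : List A2) :
    (apply σ)^[n] (u ++ v) = (apply σ)^[n] u ++ (apply σ)^[n] v := by
  induction n with
  | zero => rfl
  | succ n ih => simp only [Function.iterate_succ_apply', ih, apply_append]

lemma iterate_apply_nil (σ : Subst) (n : ℕ) : (apply σ)^[n] [] = [] := by
  induction n with
  | zero => rfl
  | succ n ih => simp only [Function.iterate_succ_apply', ih, apply_nil]

lemma iterate_apply (σ : Subst) (n : ℕ) (w : List A2) :
    (apply σ)^[n] w = apply (substPow σ n) w := by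
  induction w with
  | nil => simp [iterate_apply_nil]
  | cons i w ih =>
    rw [← List.singleton_append, iterate_apply_append, ih, apply_append]
    simp [substPow]

lemma substPow_add (σ : Subst) (m n : ℕ) (x : A2) :
    substPow σ (m + n) x = apply (substPow σ m) (substPow σ n x) := by
  rw [← iterate_apply]; simp only [substPow]; rw [Function.iterate_add_apply]

lemma Conj.pow {σ ρ : Subst} (h : Conj σ ρ) (n : ℕ) : Conj (substPow σ n) (substPow ρ n) := by
  obtain ⟨w, h⟩ := h
  induction n with
  | zero => exact Conj.refl _
  | succ n ih =>
    obtain ⟨v, hv⟩ := (conj_iff _ _).1 ih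
    rw [conj_iff]
    refine ⟨endo σ v * w, fun i => ?_⟩
    rw [substPow_succ, substPow_succ, ← endo_toFG, ← endo_toFG, hv, _root_.map_mul, _root_.map_mul,
      _root_.map_inv, h (toFG _)]
    group

lemma count_apply (σ : Subst) (i : A2) (w : List A2) :
    ((apply σ w).count i : ℤ) = M σ i 0 * w.count 0 + M σ i 1 * w.count 1 := by
  induction w with
  | nil => simp
  | cons j w ih =>
    rw [apply_cons, List.count_append]
    push_cast
    rw [ih]
    fin_cases j <;> simp [M] <;> ring

lemma M_substPow (σ : Subst) (n : ℕ) : M (substPow σ n) = M σ ^ n := by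
  induction n with
  | zero =>
    ext i j
    fin_cases i <;> fin_cases j <;> simp [M, substPow]
  | succ n ih =>
    rw [pow_succ', ← ih]
    ext i j
    rw [Matrix.mul_apply, Fin.sum_univ_two]
    simp only [M, substPow_succ]
    rw [count_apply]; rfl

lemma length_apply_ge {σ : Subst} {k : ℕ} (h : ∀ i, k ≤ (σ i).length) (w : List A2) :
    k * w.length ≤ (apply σ w).length := by
  induction w with
  | nil => simp
  | cons i w ih =>
    have := h i
    simp only [apply_cons, List.length_append, List.length_cons]
    rw [mul_add]; omega

lemma NonErasing.one_le {σ : Subst} (h : NonErasing σ) (i : A2) : 1 ≤ (σ i).length :=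
  List.length_pos_iff.2 (h i)

lemma NonErasing.substPow {σ : Subst} (h : NonErasing σ) (n : ℕ) : NonErasing (substPow σ n) := by
  induction n with
  | zero => intro i; simp [TwoSubst.substPow]
  | succ n ih =>
    intro i
    rw [substPow_succ]
    have := length_apply_ge h.one_le (TwoSubst.substPow σ n i)
    have h2 := ih.one_le i
    intro h3
    rw [h3] at this
    simp at this
    simp [this] at h2

lemma length_eq_count (w : List A2) : w.length = w.count 0 + w.count 1 := by
  induction w with
  | nil => rfl
  | cons i w ih => fin_cases i <;> simp [ih] <;> omega

lemma exists_mem_all {σ : Subst} (h : Primitive σ) : ∃ n, ∀ i j, i ∈ substPow σ n j := by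
  obtain ⟨n, _, h⟩ := h
  refine ⟨n, fun i j => ?_⟩
  have := h i j
  rw [← M_substPow] at this
  simpa [M, List.count_pos_iff] using this

lemma exists_long {σ : Subst} (h : Primitive σ) (K : ℕ) : ∃ m, K ≤ (substPow σ m 0).length := by
  obtain ⟨n, h⟩ := exists_mem_all h
  have h2 : ∀ i, 2 ≤ (substPow σ n i).length := fun i => by
    have h0 := List.count_pos_iff.2 (h 0 i)
    have h1 := List.count_pos_iff.2 (h 1 i)
    have := length_eq_count (substPow σ n i)
    omega
  induction K with
  | zero => exact ⟨0, by simp⟩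
  | succ K ih =>
    obtain ⟨m, hm⟩ := ih
    refine ⟨n + max m 0, ?_⟩
    rcases Nat.eq_zero_or_pos K with rfl | hK
    · have h3 := h2 0
      have := length_apply_ge h2 (substPow σ m 0)
      by_cases h0 : (substPow σ m 0).length = 0
      · exfalso
        clear hm this
        induction m with
        | zero => simp [substPow] at h0
        | succ m ih =>
          -- every σ^n i nonempty forces σ nonerasing
          apply ih
          by_contra hne
          have hc : ∃ c, c ∈ substPow σ m 0 := List.exists_mem_of_length_pos (by omega)
          have : ∀ n : ℕ, 0 < (substPow σ (n + m) 0).length → 0 < (substPow σ m 0).length := by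
            intros; omega
          have e : substPow σ (m + n) 0 = [] ∨ n = 0 := by
            rcases n with _ | n
            · right; rfl
            · left
              rw [show m + (n + 1) = n + (m + 1) by omega, substPow_add, List.length_eq_zero_iff.1 h0]
              rfl
          rcases e with e | e
          · rw [show m + n = n + m by omega, substPow_add] at e
            have h5 := length_apply_ge h2 (substPow σ m 0)
            rw [e] at h5
            simp at h5
            simp [h5] at hne
          · subst e
            have := h2 0
            simp [substPow] at this
      · rw [max_eq_left (by omega), substPow_add]; omega
    · rw [max_eq_left (by omega), substPow_add]
      have := length_apply_ge h2 (substPow σ m 0)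
      omega

/-- language -/
def Lang (σ : Subst) (w : List A2) : Prop := ∃ (n : ℕ) (x : A2), w <:+: substPow σ n x

lemma exists_middle {ρ : Subst} (hne : NonErasing ρ) (h : Primitive ρ) (c : A2) (K : ℕ) :
    ∃ m l r, substPow ρ m 0 = l ++ c :: r ∧ K ≤ l.length ∧ K ≤ r.length := by
  obtain ⟨m, hm⟩ := exists_long h (2 * K + 1)
  obtain ⟨n, hn⟩ := exists_mem_all h
  set W := substPow ρ m 0 with hW
  obtain ⟨y, hy⟩ : ∃ y, W = W.take K ++ y :: W.drop (K + 1) :=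
    ⟨W[K]'(by omega), by simp⟩
  obtain ⟨s, t, hst⟩ := List.append_of_mem (hn c y)
  refine ⟨n + m, apply (substPow ρ n) (W.take K) ++ s, t ++ apply (substPow ρ n) (W.drop (K + 1)),
    ?_, ?_, ?_⟩
  · rw [substPow_add, ← hW]
    conv_lhs => rw [hy]
    rw [apply_append, apply_cons, hst]
    simp
  · have := length_apply_ge (hne.substPow n).one_le (W.take K)
    simp only [List.length_take, List.length_append] at *
    omega
  · have := length_apply_ge (hne.substPow n).one_le (W.drop (K + 1))
    simp only [List.length_drop, List.length_append] at *
    omega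

lemma lang_subset {σ ρ : Subst} (hσ : NonErasing σ) (hρ : NonErasing ρ) (hp : Primitive ρ)
    (h : Conj σ ρ) {f : List A2} (hf : Lang σ f) : Lang ρ f := by
  obtain ⟨n, c, hf⟩ := hf
  obtain ⟨w, hw⟩ := (h.pow n).symm
  obtain ⟨m, l, r, hm, hl, hr⟩ := exists_middle hρ hp c w.norm
  refine ⟨n + m, 0, hf.trans ?_⟩
  have hw2 := hw (toFG (substPow ρ m 0))
  rw [endo_toFG, endo_toFG, ← substPow_add, hm, apply_append, apply_cons, ← List.append_assoc] at hw2
  refine middle_infix hw2 ?_ ?_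
  · exact hl.trans (by simpa using length_apply_ge (hσ.substPow n).one_le l)
  · exact hr.trans (by simpa using length_apply_ge (hσ.substPow n).one_le r)

lemma Conj.hull_eq {σ ρ : Subst} (hσ : NonErasing σ) (hρ : NonErasing ρ) (hp : Primitive σ)
    (h : Conj σ ρ) : Hull σ = Hull ρ := by
  have hp' : Primitive ρ := by
    unfold Primitive; rw [← h.M_eq]; exact hp
  ext u
  exact ⟨fun hu w hw => lang_subset hσ hρ hp' h (hu w hw),
    fun hu w hw => lang_subset hρ hσ hp h.symm (hu w hw)⟩

lemma hull_nonempty {σ : Subst} (hp : Primitive σ) : (Hull σ).Nonempty := by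
  choose m hm using fun K => exists_long hp (2 * K + 1)
  let W : ℕ → List A2 := fun K => substPow σ (m K) 0
  let v : ℕ → ℤ → A2 := fun K i => (W K).getD (i + K).toNat 0
  let F := Filter.hyperfilter ℕ
  let u : ℤ → A2 := fun i => by classical exact if ∀ᶠ K in F, v K i = 0 then 0 else 1
  have hu : ∀ i, ∀ᶠ K in F, v K i = u i := by
    intro i
    by_cases h : ∀ᶠ K in F, v K i = 0
    · simp only [u, h, if_true]
    · simp only [u, h, if_false]
      filter_upwards [Ultrafilter.eventually_not.2 h] with K hK
      generalize v K i = c at hK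
      fin_cases c <;> simp_all
  refine ⟨u, ?_⟩
  rintro w ⟨k, hk⟩
  have h1 : ∀ᶠ K in F, ∀ i ∈ Finset.range w.length, v K (k + i) = u (k + i) := by
    rw [Filter.eventually_all_finset]
    intro i _; exact hu _
  have h2 : ∀ᶠ K in (F : Filter ℕ), k.natAbs + w.length ≤ K := by
    have : (F : Filter ℕ) ≤ Filter.atTop := by
      rw [← Nat.cofinite_eq_atTop]; exact Filter.hyperfilter_le_cofinite
    exact this (Filter.eventually_ge_atTop _)
  obtain ⟨K, hK1, hK2⟩ := (h1.and h2).exists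
  refine ⟨m K, 0, ?_⟩
  have : w = ((W K).drop (k + K).toNat).take w.length := by
    have hmK : 2 * K + 1 ≤ (W K).length := hm K
    apply List.ext_getElem
    · simp only [List.length_take, List.length_drop]; omega
    · intro i h3 h4
      have e1 : w[i] = u (k + i) := by
        have := congrArg (fun l => l[i]?) hk
        simpa [h3, ← List.map_eq_flatMap] using this
      rw [e1, ← hK1 i (by simpa using h3)]
      simp only [List.getElem_take, List.getElem_drop, v]
      rw [List.getD_eq_getElem _ _ (by omega)]
      congr 1; omega
  rw [this]
  exact (List.take_prefix _ _).isInfix.trans (List.drop_suffix _ _).isInfix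

def swapSub (ρ : Subst) : Subst := comp Esub (comp ρ Esub)

lemma apply_Esub (w : List A2) : apply Esub w = w.map swapA := by
  induction w with
  | nil => rfl
  | cons i w ih => rw [apply_cons, ih]; fin_cases i <;> simp [Esub, swapA]

lemma swapA_swapA (i : A2) : swapA (swapA i) = i := by fin_cases i <;> simp [swapA]

lemma Esub_eq (i : A2) : Esub i = [swapA i] := by fin_cases i <;> simp [Esub, swapA]

lemma swapSub_apply (ρ : Subst) (i : A2) : swapSub ρ i = (ρ (swapA i)).map swapA := by
  simp [swapSub, comp, apply_Esub, Esub_eq]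

lemma map_swap_swap (w : List A2) : (w.map swapA).map swapA = w := by
  simp [Function.comp_def, swapA_swapA]

lemma apply_swapSub (ρ : Subst) (w : List A2) :
    apply (swapSub ρ) w = (apply ρ (w.map swapA)).map swapA := by
  induction w with
  | nil => rfl
  | cons i w ih => simp [ih, swapSub_apply]

lemma substPow_swapSub (ρ : Subst) (n : ℕ) (i : A2) :
    substPow (swapSub ρ) n i = (substPow ρ n (swapA i)).map swapA := by
  induction n with
  | zero => simp [substPow, swapA_swapA]
  | succ n ih => rw [substPow_succ, substPow_succ, ih, apply_swapSub, map_swap_swap]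

lemma swapSub_nonErasing {ρ : Subst} (h : NonErasing ρ) : NonErasing (swapSub ρ) := by
  intro i; rw [swapSub_apply]; simpa using h _

lemma isFactor_swap {w : List A2} {u : ℤ → A2} (h : IsFactor w u) :
    IsFactor (w.map swapA) (swapA ∘ u) := by
  obtain ⟨k, hk⟩ := h
  refine ⟨k, ?_⟩
  conv_lhs => rw [hk]
  simp

lemma swap_mem_hull {ρ : Subst} {u : ℤ → A2} (h : u ∈ Hull ρ) : swapA ∘ u ∈ Hull (swapSub ρ) := by
  intro w hw
  have h1 := isFactor_swap hw
  rw [← Function.comp_assoc, show swapA ∘ swapA = id from funext swapA_swapA, Function.id_comp] at h1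
  obtain ⟨n, x, hx⟩ := h _ h1
  refine ⟨n, swapA x, ?_⟩
  rw [substPow_swapSub, swapA_swapA]
  have := hx.map swapA
  rwa [map_swap_swap] at this

lemma swapSub_swapSub (ρ : Subst) : swapSub (swapSub ρ) = ρ := by
  funext i; rw [swapSub_apply, swapSub_apply, map_swap_swap, swapA_swapA]

lemma hull_swapSub (ρ : Subst) :
    Hull (swapSub ρ) = (fun u : ℤ → A2 => swapA ∘ u) '' Hull ρ := by
  ext u
  constructor
  · intro h
    refine ⟨swapA ∘ u, ?_, ?_⟩
    · have := swap_mem_hull h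
      rwa [swapSub_swapSub] at this
    · funext i; simp [swapA_swapA]
  · rintro ⟨v, hv, rfl⟩; exact swap_mem_hull hv

end TwoSubst

namespace TwoSubst
open FreeGroup

noncomputable def val (a b : ℝ) (w : List A2) : ℝ := a * w.count 0 + b * w.count 1

lemma val_append (a b : ℝ) (u v : List A2) : val a b (u ++ v) = val a b u + val a b v := by
  simp [val]; ring

lemma val_le (a b : ℝ) (w : List A2) : |val a b w| ≤ (|a| + |b|) * w.length := by
  have h := length_eq_count w
  rw [h]
  unfold val
  push_cast
  refine (abs_add_le _ _).trans ?_
  rw [abs_mul, abs_mul, Nat.abs_cast, Nat.abs_cast]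
  have := mul_nonneg (abs_nonneg a) (Nat.cast_nonneg (α := ℝ) (w.count 1))
  have := mul_nonneg (abs_nonneg b) (Nat.cast_nonneg (α := ℝ) (w.count 0))
  nlinarith

structure IsLeft (σ : Subst) (lam a b : ℝ) : Prop where
  h0 : a * M σ 0 0 + b * M σ 1 0 = lam * a
  h1 : a * M σ 0 1 + b * M σ 1 1 = lam * b

lemma val_apply {σ : Subst} {lam a b : ℝ} (h : IsLeft σ lam a b) (w : List A2) :
    val a b (apply σ w) = lam * val a b w := by
  have e0 := count_apply σ 0 w
  have e1 := count_apply σ 1 w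
  have e0' : ((apply σ w).count 0 : ℝ) = M σ 0 0 * w.count 0 + M σ 0 1 * w.count 1 := by
    exact_mod_cast e0
  have e1' : ((apply σ w).count 1 : ℝ) = M σ 1 0 * w.count 0 + M σ 1 1 * w.count 1 := by
    exact_mod_cast e1
  unfold val
  rw [e0', e1']
  linear_combination (w.count 0 : ℝ) * h.h0 + (w.count 1 : ℝ) * h.h1

lemma prefix_apply (σ : Subst) (W w : List A2) (h : w <+: apply σ W) :
    ∃ W' r c, W' <+: W ∧ w = apply σ W' ++ r ∧ r <+: σ c := by
  induction W generalizing w with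
  | nil =>
    refine ⟨[], [], 0, by simp, ?_, by simp⟩
    simpa using h
  | cons i W ih =>
    rw [apply_cons] at h
    rcases List.prefix_or_prefix_of_prefix h (List.prefix_append (σ i) _) with h1 | ⟨t, rfl⟩
    · exact ⟨[], w, i, by simp, by simp, h1⟩
    · obtain ⟨W', r, c, hW, hw, hr⟩ := ih t ((List.prefix_append_right_inj _).1 h)
      exact ⟨i :: W', r, c, by simpa using hW, by rw [hw]; simp, hr⟩

lemma bounded {σ : Subst} (hne : NonErasing σ) {lam a b : ℝ} (h : IsLeft σ lam a b)
    (hl0 : 0 ≤ lam) (hl1 : lam < 1) :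
    ∃ B, 0 ≤ B ∧ ∀ w, Lang σ w → |val a b w| ≤ B := by
  set N : ℝ := (((σ 0).length + (σ 1).length : ℕ) : ℝ) with hN
  set C : ℝ := (|a| + |b|) * N with hC
  have hab : 0 ≤ |a| + |b| := by positivity
  have hC0 : 0 ≤ C := by positivity
  have hpos : 0 < 1 - lam := by linarith
  have key : ∀ n x w, w <+: substPow σ n x → |val a b w| ≤ C / (1 - lam) := by
    intro n x
    have hCB : C ≤ C / (1 - lam) := by
      rw [le_div_iff₀ hpos]; nlinarith
    induction n with
    | zero =>
      intro w hw
      refine le_trans ?_ hCB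
      refine (val_le a b w).trans ?_
      apply mul_le_mul_of_nonneg_left _ hab
      have h1 := hw.length_le
      have h2 := hne.one_le 0
      rw [substPow_zero] at h1
      simp only [List.length_singleton] at h1
      rw [hN]; exact_mod_cast (by omega)
    | succ n ih =>
      intro w hw
      rw [substPow_succ] at hw
      obtain ⟨W', r, c, hW, rfl, hr⟩ := prefix_apply _ _ _ hw
      rw [val_append, val_apply h]
      have h1 := ih W' hW
      have h2 : |val a b r| ≤ C := by
        refine (val_le a b r).trans ?_
        apply mul_le_mul_of_nonneg_left _ hab
        have h1 := hr.length_le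
        rw [hN]
        have : r.length ≤ (σ 0).length + (σ 1).length := by
          fin_cases c <;> simp at h1 <;> omega
        exact_mod_cast this
      refine (abs_add_le _ _).trans ?_
      rw [abs_mul, abs_of_nonneg hl0]
      have h3 : lam * |val a b W'| ≤ lam * (C / (1 - lam)) := mul_le_mul_of_nonneg_left h1 hl0
      have h4 : lam * (C / (1 - lam)) + C = C / (1 - lam) := by field_simp; ring
      linarith
  refine ⟨2 * (C / (1 - lam)), by positivity, ?_⟩
  rintro w ⟨n, x, p, q, e⟩
  have h1 := key n x p ⟨w ++ q, by rw [← e]; simp⟩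
  have h2 := key n x (p ++ w) ⟨q, e⟩
  rw [val_append] at h2
  rw [abs_le] at *
  constructor <;> linarith [h1.1, h1.2, h2.1, h2.2]

lemma cross_zero {σ ρ : Subst} (hσ : NonErasing σ) (hρ : NonErasing ρ) {lam a b c d : ℝ}
    (h : IsLeft σ lam a b) (h' : IsLeft ρ lam c d) (hl0 : 0 ≤ lam) (hl1 : lam < 1)
    {u : ℤ → A2} (hu : u ∈ Hull σ) (hu' : u ∈ Hull ρ) : a * d - b * c = 0 := by
  by_contra hD
  obtain ⟨B, hB0, hB⟩ := bounded hσ h hl0 hl1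
  obtain ⟨B', hB0', hB'⟩ := bounded hρ h' hl0 hl1
  have hD' : 0 < |a * d - b * c| := abs_pos.2 hD
  obtain ⟨N, hN⟩ := exists_nat_gt ((|d| * B + |b| * B' + |a| * B' + |c| * B) / |a * d - b * c|)
  rw [div_lt_iff₀ hD'] at hN
  let w : List A2 := (List.range N).map fun i : ℕ => u (0 + (i : ℤ))
  have hwl : w.length = N := by simp [w]
  have hw : IsFactor w u := ⟨0, by rw [hwl]; simp [w, ← List.map_eq_flatMap]⟩
  have h1 := hB w (hu w hw)
  have h2 := hB' w (hu' w hw)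
  have e0 : (a * d - b * c) * w.count 0 = d * val a b w - b * val c d w := by unfold val; ring
  have e1 : (a * d - b * c) * w.count 1 = a * val c d w - c * val a b w := by unfold val; ring
  have i0 : |a * d - b * c| * w.count 0 ≤ |d| * B + |b| * B' := by
    have := congrArg abs e0
    rw [abs_mul, Nat.abs_cast] at this
    rw [this]
    refine (abs_sub _ _).trans ?_
    rw [abs_mul, abs_mul]
    gcongr
  have i1 : |a * d - b * c| * w.count 1 ≤ |a| * B' + |c| * B := by
    have := congrArg abs e1
    rw [abs_mul, Nat.abs_cast] at this
    rw [this]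
    refine (abs_sub _ _).trans ?_
    rw [abs_mul, abs_mul]
    gcongr
  have hc : (N : ℝ) = w.count 0 + w.count 1 := by
    have := length_eq_count w
    rw [hwl] at this
    exact_mod_cast this
  rw [hc] at hN
  nlinarith

lemma offdiag_pos {σ : Subst} (h : Primitive σ) : 0 < M σ 0 1 ∧ 0 < M σ 1 0 := by
  obtain ⟨n, hn, h⟩ := h
  have hnn : ∀ i j, 0 ≤ M σ i j := fun i j => by simp [M]
  constructor
  · by_contra hc
    have h0 : M σ 0 1 = 0 := le_antisymm (not_lt.1 hc) (hnn _ _)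
    have : ∀ n, (M σ ^ n) 0 1 = 0 := by
      intro n
      induction n with
      | zero => simp
      | succ n ih => rw [pow_succ, Matrix.mul_apply, Fin.sum_univ_two, ih, h0]; simp
    have := this n
    have := h 0 1
    omega
  · by_contra hc
    have h0 : M σ 1 0 = 0 := le_antisymm (not_lt.1 hc) (hnn _ _)
    have : ∀ n, (M σ ^ n) 1 0 = 0 := by
      intro n
      induction n with
      | zero => simp
      | succ n ih => rw [pow_succ, Matrix.mul_apply, Fin.sum_univ_two, ih, h0]; simp
    have := this n
    have := h 1 0
    omega

lemma exists_lam {t : ℝ} (ht : 3 ≤ t) : ∃ lam : ℝ, 0 ≤ lam ∧ lam < 1 ∧ lam ^ 2 - t * lam + 1 = 0 := by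
  have h1 : 0 ≤ t ^ 2 - 4 := by nlinarith
  have h2 := Real.sq_sqrt h1
  have h3 := Real.sqrt_nonneg (t ^ 2 - 4)
  refine ⟨(t - √(t ^ 2 - 4)) / 2, ?_, ?_, ?_⟩
  · have : √(t ^ 2 - 4) ≤ t := by rw [Real.sqrt_le_left (by linarith)]; linarith
    linarith
  · have : t - 2 < √(t ^ 2 - 4) := by
      apply Real.lt_sqrt_of_sq_lt; nlinarith
    linarith
  · nlinarith

lemma isLeft_of {σ : Subst} (hdet : (M σ).det = 1) {lam : ℝ}
    (hl : lam ^ 2 - ((M σ 0 0 : ℝ) + M σ 1 1) * lam + 1 = 0) :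
    IsLeft σ lam (M σ 1 0) (lam - M σ 0 0) := by
  rw [Matrix.det_fin_two] at hdet
  have hd : (M σ 0 0 : ℝ) * M σ 1 1 - M σ 0 1 * M σ 1 0 = 1 := by exact_mod_cast hdet
  constructor
  · ring
  · linear_combination -hl - hd

lemma M_entries {σ : Subst} (hprim : Primitive σ) (hdet : (M σ).det = 1) :
    (3 : ℤ) ≤ M σ 0 0 + M σ 1 1 := by
  obtain ⟨h1, h2⟩ := offdiag_pos hprim
  rw [Matrix.det_fin_two] at hdet
  have : 0 ≤ M σ 0 0 := by simp [M]
  have : 0 ≤ M σ 1 1 := by simp [M]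
  by_contra hc
  have := mul_pos h1 h2
  nlinarith [sq_nonneg (M σ 0 0 - M σ 1 1)]

lemma cross_M {σ ρ : Subst} (hσ : NonErasing σ) (hρ : NonErasing ρ) (hprim : Primitive σ)
    (hdet : (M σ).det = 1) (hdet' : (M ρ).det = 1)
    (htr : M σ 0 0 + M σ 1 1 = M ρ 0 0 + M ρ 1 1) (hh : Hull σ = Hull ρ) :
    ∃ lam : ℝ, lam ^ 2 - ((M σ 0 0 : ℝ) + M σ 1 1) * lam + 1 = 0 ∧
      (M σ 1 0 : ℝ) * (lam - M ρ 0 0) = (lam - M σ 0 0) * M ρ 1 0 := by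
  obtain ⟨lam, h0, h1, h2⟩ := exists_lam (t := (M σ 0 0 : ℝ) + M σ 1 1)
    (by exact_mod_cast M_entries hprim hdet)
  refine ⟨lam, h2, ?_⟩
  obtain ⟨u, hu⟩ := hull_nonempty hprim
  have htr' : (M σ 0 0 : ℝ) + M σ 1 1 = M ρ 0 0 + M ρ 1 1 := by exact_mod_cast htr
  have := cross_zero hσ hρ (isLeft_of hdet h2) (isLeft_of hdet' (by rw [← htr']; exact h2)) h0 h1
    hu (by rw [← hh]; exact hu)
  linarith

end TwoSubst

namespace TwoSubst
open FreeGroup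

lemma isReduced_append {l₁ l₂ : List (A2 × Bool)} (h1 : IsReduced l₁) (h2 : IsReduced l₂)
    (h : ∀ x ∈ l₁.getLast?, ∀ y ∈ l₂.head?, x.1 = y.1 → x.2 = y.2) : IsReduced (l₁ ++ l₂) :=
  List.isChain_append.2 ⟨h1, h2, h⟩

lemma toWord_mk_mul {l : List (A2 × Bool)} {X : FreeGroup A2} (h : IsReduced (l ++ X.toWord)) :
    (mk l * X).toWord = l ++ X.toWord := by
  conv_lhs => rw [← mk_toWord (x := X), mul_mk, toWord_mk, h.reduce_eq]

lemma mem_invRev_pos {w : List A2} {x : A2 × Bool} (h : x ∈ invRev (pos w)) : x.2 = false := by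
  simp only [invRev, pos, List.map_map, List.mem_reverse, List.mem_map] at h
  obtain ⟨a, _, rfl⟩ := h; rfl

lemma isReduced_neg (w : List A2) : IsReduced (invRev (pos w)) :=
  isReduced_same _ false fun _ => mem_invRev_pos

def PP (s : A2 → List A2) (z : List A2) : A2 × Bool → List (A2 × Bool)
  | (i, true) => pos (s i)
  | (i, false) => invRev (pos z) ++ invRev (pos (s i))

lemma mk_true (σ : Subst) (i : A2) : endo σ (mk [(i, true)]) = mk (pos (σ i)) := by
  rw [← toFG_eq_mk]; exact endo_of σ i

lemma mk_false (σ : Subst) (i : A2) : endo σ (mk [(i, false)]) = mk (invRev (pos (σ i))) := by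
  have : (mk [(i, false)] : FreeGroup A2) = (of i)⁻¹ := by simp [of, inv_mk, invRev]
  rw [this, _root_.map_inv, endo_of, toFG_eq_mk, inv_mk]

lemma mk_cons' (g : A2 × Bool) (L : List (A2 × Bool)) : mk (g :: L) = mk [g] * mk L := by
  rw [mul_mk]; rfl

section
variable {s : A2 → List A2} {z : List A2} {hd la : A2 → A2}

lemma pp_prefix (hhd : ∀ i, ∃ t, s i = hd i :: t) (hla : ∀ i, ∃ t, s i = t ++ [la i])
    (hhd' : ∀ i j, i ≠ j → hd i ≠ hd j) (hla' : ∀ i j, i ≠ j → la i ≠ la j)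
    (L : List (A2 × Bool)) : ∀ g, IsReduced (g :: L) →
      PP s z g <+: (endo (fun i => s i ++ z) (mk (g :: L))).toWord := by
  induction L with
  | nil =>
    rintro ⟨i, b⟩ -
    cases b
    · rw [mk_false, toWord_mk, (isReduced_neg _).reduce_eq]
      simp [PP]
    · rw [mk_true, toWord_mk, (isReduced_pos _).reduce_eq]
      simp [PP]
  | cons h L ih =>
    rintro ⟨i, b⟩ hred
    rw [isReduced_cons_cons] at hred
    obtain ⟨hgh, hred⟩ := hred
    obtain ⟨R, hR⟩ := ih h hred
    rw [mk_cons', _root_.map_mul]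
    set X := endo (fun i => s i ++ z) (mk (h :: L)) with hX
    have hXr : IsReduced X.toWord := isReduced_toWord
    obtain ⟨j, b'⟩ := h
    obtain ⟨ti, hti⟩ := hhd i
    obtain ⟨tj, htj⟩ := hhd j
    obtain ⟨ri, hri⟩ := hla i
    obtain ⟨rj, hrj⟩ := hla j
    cases b <;> cases b'
    · rw [mk_false, toWord_mk_mul]
      · simp [PP]
      · refine isReduced_append (isReduced_neg _) hXr ?_
        intro x hx y hy _
        rw [mem_invRev_pos (List.mem_of_mem_getLast? hx)]
        rw [← hR, PP, ← invRev_append, ← pos_append] at hy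
        have : invRev (pos (s j ++ z)) ≠ [] := by
          rw [htj]; simp [invRev]
        obtain ⟨k, K, hK⟩ := List.exists_cons_of_ne_nil this
        rw [hK] at hy
        simp at hy
        subst hy
        rw [mem_invRev_pos (w := s j ++ z) (by rw [hK]; simp)]
    · have hij : i ≠ j := fun e => by simpa using hgh e
      rw [mk_false, toWord_mk_mul]
      · simp [PP]
      · refine isReduced_append (isReduced_neg _) hXr ?_
        intro x hx y hy hxy
        rw [← hR, PP, htj] at hy
        simp at hy
        rw [hti] at hx
        simp [invRev] at hx
        subst hx hy
        exact absurd hxy (hhd' i j hij)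
    · have hij : i ≠ j := fun e => by simpa using hgh e
      have e : mk (pos (s i ++ z)) * X = mk (pos (s i)) * mk (invRev (pos (s j)) ++ R) := by
        rw [← mk_toWord (x := X), ← hR, PP]
        simp only [pos_append, ← mul_mk, ← inv_mk]
        group
      have hr2 : IsReduced (invRev (pos (s j)) ++ R) := by
        refine hXr.infix ?_
        rw [← hR, PP]
        exact ⟨invRev (pos z), [], by simp⟩
      have : IsReduced (pos (s i) ++ (invRev (pos (s j)) ++ R)) := by
        refine isReduced_append (isReduced_pos _) hr2 ?_
        intro x hx y hy hxy
        rw [hri] at hx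
        rw [hrj] at hy
        simp [invRev] at hx hy
        subst hx hy
        exact absurd hxy (hla' i j hij)
      rw [mk_true, e, mul_mk, toWord_mk, this.reduce_eq]
      simp [PP]
    · rw [mk_true, toWord_mk_mul]
      · simp [PP]
      · refine isReduced_append (isReduced_pos _) hXr ?_
        intro x hx y hy _
        rw [mem_pos (List.mem_of_mem_getLast? hx)]
        rw [← hR, PP, htj] at hy
        simp at hy
        subst hy; rfl

lemma pingpong (hhd : ∀ i, ∃ t, s i = hd i :: t) (hla : ∀ i, ∃ t, s i = t ++ [la i])
    (hhd' : ∀ i j, i ≠ j → hd i ≠ hd j) (hla' : ∀ i j, i ≠ j → la i ≠ la j)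
    (hs : Function.Surjective (endo (fun i => s i ++ z))) :
    ∀ c, z = [] ∧ ∃ i, s i = [c] := by
  intro c
  have pre := pp_prefix (z := z) hhd hla hhd' hla'
  obtain ⟨y, hy⟩ := hs (of c)
  have hyr : IsReduced y.toWord := isReduced_toWord
  rcases hL : y.toWord with _ | ⟨⟨i, b⟩, L⟩
  · rw [toWord_eq_nil_iff] at hL
    subst hL
    rw [_root_.map_one] at hy
    exact absurd hy (one_ne_of c)
  have hyL : y = mk ((i, b) :: L) := by rw [← hL, mk_toWord]
  have h1 := pre L (i, b) (by rw [← hL]; exact hyr)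
  rw [← hyL, hy, toWord_of] at h1
  obtain ⟨ti, hti⟩ := hhd i
  cases b
  · exfalso
    have hm : (hd i, false) ∈ PP s z (i, false) := by
      rw [PP, hti]; simp [invRev]
    simpa using h1.subset hm
  have hsi : s i = [c] := by
    rw [PP, hti, pos_cons] at h1
    have h2 := h1.length_le
    simp [pos] at h1 h2
    subst h2
    rw [hti, h1.1]
  refine ⟨?_, i, hsi⟩
  rw [hyL, mk_cons', _root_.map_mul, mk_true, ← toFG_eq_mk] at hy
  simp only [hsi] at hy
  rw [toFG_append, toFG_cons, toFG_nil, mul_one, mul_assoc] at hy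
  have hz : endo (fun i => s i ++ z) (mk L) = (toFG z)⁻¹ := by
    rw [eq_inv_iff_mul_eq_one, mul_eq_one_iff_inv_eq]
    have := mul_eq_left.1 hy
    rw [eq_comm, ← mul_eq_one_iff_eq_inv]; exact this
  rcases L with _ | ⟨⟨j, b⟩, L⟩
  · rw [← one_eq_mk, _root_.map_one] at hz
    apply toFG_injective
    rw [toFG_nil, ← inv_inv (toFG z), ← hz, inv_one]
  · exfalso
    have h2 := pre L (j, b) (by
      rw [hL] at hyr; exact hyr.infix ⟨[(i, true)], [], by simp⟩)
    rw [hz, toWord_inv, toWord_toFG] at h2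
    obtain ⟨tj, htj⟩ := hhd j
    cases b
    · have := h2.length_le
      rw [PP, htj] at this
      simp at this
    · have hm : (hd j, true) ∈ PP s z (j, true) := by
        rw [PP, htj]; simp
      simpa using mem_invRev_pos (h2.subset hm)
end

lemma common_suffix (u v : List A2) : ∃ z u' v', u = u' ++ z ∧ v = v' ++ z ∧
    (u' = [] ∨ v' = [] ∨ ∃ p q x y, u' = p ++ [x] ∧ v' = q ++ [y] ∧ x ≠ y) := by
  induction u using List.reverseRecOn generalizing v with
  | nil => exact ⟨[], [], v, by simp, by simp, Or.inl rfl⟩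
  | append_singleton u x ih =>
    rcases List.eq_nil_or_concat v with rfl | ⟨v, y, rfl⟩
    · exact ⟨[], u ++ [x], [], by simp, by simp, Or.inr (Or.inl rfl)⟩
    · by_cases hxy : x = y
      · subst hxy
        obtain ⟨z, u', v', rfl, rfl, h⟩ := ih v
        exact ⟨z ++ [x], u', v', by simp, by simp, h⟩
      · exact ⟨[], u ++ [x], v ++ [y], by simp, by simp, Or.inr (Or.inr ⟨u, v, x, y, rfl, rfl, hxy⟩)⟩

lemma first_diff (u v : List A2) (hl : u.length = v.length) (h : u ≠ v) :
    ∃ p x y s t, u = p ++ x :: s ∧ v = p ++ y :: t ∧ x ≠ y := by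
  induction u generalizing v with
  | nil => exact absurd (List.length_eq_zero_iff.1 hl.symm).symm h
  | cons a u ih =>
    cases v with
    | nil => simp at hl
    | cons b v =>
      by_cases hab : a = b
      · subst hab
        obtain ⟨p, x, y, s, t, rfl, rfl, hxy⟩ := ih v (by simpa using hl) (by simpa using h)
        exact ⟨a :: p, x, y, s, t, by simp, by simp, hxy⟩
      · exact ⟨[], a, b, u, v, by simp, by simp, hab⟩

lemma shift (p : List A2) : ∀ (σ : Subst) (x y : A2) (s t : List A2), NonErasing σ →
    σ 0 ++ σ 1 = p ++ x :: s → σ 1 ++ σ 0 = p ++ y :: t → x ≠ y →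
    ∃ (σ' : Subst) (hd : A2 → A2), Conj σ σ' ∧ (∀ i, ∃ t, σ' i = hd i :: t) ∧
      (∀ i j, i ≠ j → hd i ≠ hd j) := by
  induction p with
  | nil =>
    intro σ x y s t hne h0 h1 hxy
    refine ⟨σ, ![x, y], Conj.refl _, ?_, ?_⟩
    · intro i
      obtain ⟨c, l, e⟩ := List.exists_cons_of_ne_nil (hne 0)
      obtain ⟨c', l', e'⟩ := List.exists_cons_of_ne_nil (hne 1)
      rw [e, e'] at h0 h1
      simp at h0 h1
      fin_cases i
      · exact ⟨l, by simp [e, h0.1]⟩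
      · exact ⟨l', by simp [e', h1.1]⟩
    · intro i j hij
      fin_cases i <;> fin_cases j <;> simp_all
      exact fun e => hxy e.symm
  | cons c p ih =>
    intro σ x y s t hne h0 h1 hxy
    obtain ⟨c0, l, e⟩ := List.exists_cons_of_ne_nil (hne 0)
    obtain ⟨c1, l', e'⟩ := List.exists_cons_of_ne_nil (hne 1)
    rw [e, e'] at h0 h1
    simp at h0 h1
    obtain ⟨rfl, h0⟩ := h0
    obtain ⟨rfl, h1⟩ := h1
    let τ : Subst := ![l ++ [c1], l' ++ [c1]]
    obtain ⟨σ', hd, hc, h⟩ := ih τ x y (s ++ [c1]) (t ++ [c1])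
      (by intro i; fin_cases i <;> simp [τ])
      (by
        have := congrArg (· ++ [c1]) h0
        simpa [τ] using this)
      (by
        have := congrArg (· ++ [c1]) h1
        simpa [τ] using this) hxy
    refine ⟨σ', hd, Conj.trans ?_ hc, h⟩
    rw [conj_iff]
    refine ⟨of c1, fun i => ?_⟩
    fin_cases i <;> simp [τ, e, e', mul_assoc]

lemma not_comm {σ : Subst} (hs : Function.Surjective (endo σ)) : σ 0 ++ σ 1 ≠ σ 1 ++ σ 0 := by
  intro h
  have h01 : Commute (endo σ (of 0)) (endo σ (of 1)) := by
    have := congrArg toFG h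
    simpa [Commute, SemiconjBy] using this
  have hgen : ∀ i j : A2, Commute (endo σ (of i)) (endo σ (of j)) := by
    intro i j
    fin_cases i <;> fin_cases j
    · exact Commute.refl _
    · exact h01
    · exact h01.symm
    · exact Commute.refl _
  have h1 : ∀ i y, Commute (endo σ (of i)) (endo σ y) := by
    intro i y
    induction y using FreeGroup.induction_on with
    | C1 => rw [_root_.map_one]; exact Commute.one_right _
    | of j => exact hgen i j
    | inv_of j hj => rw [_root_.map_inv]; exact hj.inv_right
    | mul a b ha hb => rw [_root_.map_mul]; exact ha.mul_right hb
  have h2 : ∀ x y, Commute (endo σ x) (endo σ y) := by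
    intro x y
    induction x using FreeGroup.induction_on with
    | C1 => rw [_root_.map_one]; exact Commute.one_left _
    | of j => exact h1 j y
    | inv_of j hj => rw [_root_.map_inv]; exact hj.inv_left
    | mul a b ha hb => rw [_root_.map_mul]; exact ha.mul_left hb
  obtain ⟨x, hx⟩ := hs (toFG [0])
  obtain ⟨y, hy⟩ := hs (toFG [1])
  have := h2 x y
  rw [hx, hy, Commute, SemiconjBy, ← toFG_append, ← toFG_append] at this
  simpa using toFG_injective this

lemma dich {σ : Subst} (hne : NonErasing σ) (hs : Function.Surjective (endo σ)) :
    ∃ σ' : Subst, Conj σ σ' ∧ ((∃ v, σ' 1 = v ++ σ' 0 ∧ v ≠ []) ∨ (∃ u, σ' 0 = u ++ σ' 1 ∧ u ≠ []) ∨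
      ∀ i, (σ' i).length = 1) := by
  obtain ⟨p, x, y, s, t, h0, h1, hxy⟩ := first_diff (σ 0 ++ σ 1) (σ 1 ++ σ 0)
    (by simp [add_comm]) (not_comm hs)
  obtain ⟨σ', hd, hc, hhd, hhd'⟩ := shift p σ x y s t hne h0 h1 hxy
  have hs' := hc.surj hs
  refine ⟨σ', hc, ?_⟩
  have hne01 : σ' 0 ≠ σ' 1 := by
    intro e
    obtain ⟨t0, e0⟩ := hhd 0
    obtain ⟨t1, e1⟩ := hhd 1
    rw [e0, e1] at e
    simp at e
    exact hhd' 0 1 (by simp) e.1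
  obtain ⟨z, u', v', hu, hv, h | h | ⟨p, q, x, y, rfl, rfl, hxy⟩⟩ := common_suffix (σ' 0) (σ' 1)
  · left
    subst h
    have : σ' 0 = z := by simpa using hu
    subst this
    refine ⟨v', hv, ?_⟩
    rintro rfl
    exact hne01 (by simpa using hv.symm)
  · right; left
    subst h
    have : σ' 1 = z := by simpa using hv
    subst this
    refine ⟨u', hu, ?_⟩
    rintro rfl
    exact hne01 (by simpa using hu)
  · right; right
    let s : A2 → List A2 := ![p ++ [x], q ++ [y]]
    have hσ' : σ' = fun i => s i ++ z := by
      funext i; fin_cases i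
      · simpa [s] using hu
      · simpa [s] using hv
    rw [hσ'] at hs'
    have hp := pingpong (s := s) (z := z) (hd := hd) (la := ![x, y])
      (by
        intro i
        obtain ⟨t, ht⟩ := hhd i
        rw [hσ'] at ht
        have hsi : s i ≠ [] := by fin_cases i <;> simp [s]
        obtain ⟨c, l, hl⟩ := List.exists_cons_of_ne_nil hsi
        simp only [hl] at ht
        simp at ht
        exact ⟨l, by rw [hl, ht.1]⟩)
      (by intro i; fin_cases i <;> simp [s])
      hhd'
      (by
        intro i j hij
        fin_cases i <;> fin_cases j <;> simp_all
        exact fun e => hxy e.symm) hs'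
    obtain ⟨hz, i0, hi0⟩ := hp 0
    obtain ⟨-, i1, hi1⟩ := hp 1
    intro i
    rw [hσ']
    simp only [hz, List.append_nil]
    have h01 : i0 ≠ i1 := by
      rintro rfl; rw [hi0] at hi1; simp at hi1
    have : i = i0 ∨ i = i1 := by
      clear hi0 hi1; revert i i0 i1; decide
    rcases this with rfl | rfl
    · simp [hi0]
    · simp [hi1]

lemma length_of_M {σ ρ : Subst} (h : M σ = M ρ) (i : A2) : (σ i).length = (ρ i).length := by
  rw [length_eq_count, length_eq_count]
  have h0 := congrFun (congrFun h 0) i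
  have h1 := congrFun (congrFun h 1) i
  simp only [M] at h0 h1
  omega

lemma nielsen_base {σ ρ : Subst} (h : M σ = M ρ) (h1 : ∀ i, (σ i).length = 1) : σ = ρ := by
  funext i
  have h2 := length_of_M h i
  rw [h1] at h2
  obtain ⟨a, ha⟩ := List.length_eq_one_iff.1 (h1 i)
  obtain ⟨b, hb⟩ := List.length_eq_one_iff.1 h2.symm
  have := congrFun (congrFun h a) i
  simp only [M, ha, hb] at this
  rw [ha, hb]
  by_cases hab : b = a
  · rw [hab]
  · simp [hab] at this

lemma red_surj {σ τ : Subst} (hs : Function.Surjective (endo σ)) (h0 : σ 0 = τ 0)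
    (h1 : σ 1 = τ 1 ++ τ 0) : Function.Surjective (endo τ) := by
  let R : Subst := ![[0], [1, 0]]
  have : σ = comp τ R := by
    funext i; fin_cases i <;> simp [comp, R, h0, h1]
  intro y
  obtain ⟨x, hx⟩ := hs y
  refine ⟨endo R x, ?_⟩
  rw [← endo_comp, ← this, hx]

lemma nielsen_lt (N : ℕ) (ih : ∀ σ ρ : Subst, (σ 0).length + (σ 1).length < N → NonErasing σ →
      NonErasing ρ → Function.Surjective (endo σ) → Function.Surjective (endo ρ) → M σ = M ρ →
      Conj σ ρ) (σ ρ : Subst) (hN : (σ 0).length + (σ 1).length = N) (hσ : NonErasing σ)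
    (hρ : NonErasing ρ) (hs : Function.Surjective (endo σ)) (hs' : Function.Surjective (endo ρ))
    (hM : M σ = M ρ) (hlt : (σ 0).length < (σ 1).length) : Conj σ ρ := by
  have step : ∀ σ : Subst, NonErasing σ → Function.Surjective (endo σ) →
      (σ 0).length < (σ 1).length → ∃ τ : Subst, NonErasing τ ∧ Function.Surjective (endo τ) ∧
        Conj σ ![τ 0, τ 1 ++ τ 0] := by
    intro σ hσ hs hlt
    obtain ⟨σ', hc, h⟩ := dich hσ hs
    have l0 := length_of_M hc.M_eq 0
    have l1 := length_of_M hc.M_eq 1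
    rcases h with ⟨v, hv, hv0⟩ | ⟨u, hu, -⟩ | h
    · refine ⟨![σ' 0, v], ?_, ?_, ?_⟩
      · intro i
        fin_cases i
        · have := hσ.one_le 0
          intro h
          simp only [Fin.zero_eta, Matrix.cons_val_zero] at h
          rw [h] at l0; simp at l0; simp [l0] at this
        · simpa using hv0
      · exact red_surj (hc.surj hs) (by simp) (by simpa using hv)
      · have : (![(![σ' 0, v] : Subst) 0, (![σ' 0, v] : Subst) 1 ++ (![σ' 0, v] : Subst) 0] : Subst) = σ' := by
          funext i; fin_cases i <;> simp [hv]
        rw [this]; exact hc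
    · have := congrArg List.length hu
      simp at this; omega
    · have := h 0
      have := h 1
      omega
  obtain ⟨τ, hτ, hτs, hτc⟩ := step σ hσ hs hlt
  obtain ⟨υ, hυ, hυs, hυc⟩ := step ρ hρ hs' (by rwa [← length_of_M hM 0, ← length_of_M hM 1])
  have hMM := hτc.M_eq.symm.trans (hM.trans hυc.M_eq)
  have hMτ : M τ = M υ := by
    have k0 : ∀ i, M τ i 0 = M υ i 0 := fun i => by
      have := congrFun (congrFun hMM i) 0
      simpa [M] using this
    have k1 : ∀ i, M τ i 1 = M υ i 1 := fun i => by
      have := congrFun (congrFun hMM i) 1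
      have h0 := k0 i
      simp [M] at this h0 ⊢
      omega
    ext i j
    fin_cases j
    · exact k0 i
    · exact k1 i
  have hl : (τ 0).length + (τ 1).length < N := by
    have l0 := length_of_M hτc.M_eq 0
    have l1 := length_of_M hτc.M_eq 1
    simp at l0 l1
    have := hτ.one_le 0
    omega
  obtain ⟨w, hw⟩ := (conj_iff _ _).1 (ih τ υ hl hτ hυ hτs hυs hMτ)
  refine hτc.trans (Conj.trans ?_ hυc.symm)
  rw [conj_iff]
  refine ⟨w, fun i => ?_⟩
  fin_cases i
  · simpa using hw 0
  · simp [hw 0, hw 1]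

lemma flip_eq (σ : Subst) : comp σ Esub = fun i => σ (swapA i) := by
  funext i; simp [comp, Esub_eq]

lemma endo_Esub_invol (x : FreeGroup A2) : endo Esub (endo Esub x) = x := by
  rw [← endo_comp]
  have : endo (comp Esub Esub) = MonoidHom.id _ := by
    apply FreeGroup.ext_hom; intro i
    change endo (comp Esub Esub) (of i) = of i
    rw [endo_of]; simp [comp, Esub_eq, swapA_swapA]
  rw [this]; rfl

lemma nielsen (N : ℕ) : ∀ σ ρ : Subst, (σ 0).length + (σ 1).length = N → NonErasing σ →
      NonErasing ρ → Function.Surjective (endo σ) → Function.Surjective (endo ρ) → M σ = M ρ →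
      Conj σ ρ := by
  induction N using Nat.strong_induction_on with
  | _ N ih =>
  have ih' : ∀ σ ρ : Subst, (σ 0).length + (σ 1).length < N → NonErasing σ →
      NonErasing ρ → Function.Surjective (endo σ) → Function.Surjective (endo ρ) → M σ = M ρ →
      Conj σ ρ := fun σ ρ h => ih _ h σ ρ rfl
  intro σ ρ hN hσ hρ hs hs' hM
  rcases lt_trichotomy (σ 0).length (σ 1).length with h | h | h
  · exact nielsen_lt N ih' σ ρ hN hσ hρ hs hs' hM h
  · have h1 : ∀ i, (σ i).length = 1 := by
      obtain ⟨σ', hc, hh⟩ := dich hσ hs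
      have l0 := length_of_M hc.M_eq 0
      have l1 := length_of_M hc.M_eq 1
      rcases hh with ⟨v, hv, hv0⟩ | ⟨u, hu, hu0⟩ | h
      · have := congrArg List.length hv
        have := List.length_pos_iff.2 hv0
        simp at *; omega
      · have := congrArg List.length hu
        have := List.length_pos_iff.2 hu0
        simp at *; omega
      · intro i; rw [length_of_M hc.M_eq i, h]
    rw [nielsen_base hM h1]; exact Conj.refl _
  · have surj : ∀ σ : Subst, Function.Surjective (endo σ) → Function.Surjective (endo (comp σ Esub)) := by
      intro σ hs y
      obtain ⟨x, hx⟩ := hs y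
      exact ⟨endo Esub x, by rw [endo_comp, endo_Esub_invol, hx]⟩
    have := nielsen_lt N ih' (comp σ Esub) (comp ρ Esub) (by simp [flip_eq, swapA]; omega)
      (by rw [flip_eq]; exact fun i => hσ _) (by rw [flip_eq]; exact fun i => hρ _)
      (surj σ hs) (surj ρ hs')
      (by
        ext i j
        have := congrFun (congrFun hM i) (swapA j)
        simpa [M, flip_eq] using this)
      (by simpa [flip_eq, swapA] using h)
    obtain ⟨w, hw⟩ := this
    refine ⟨w, fun x => ?_⟩
    have := hw (endo Esub x)
    rwa [endo_comp, endo_comp, endo_Esub_invol] at this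

end TwoSubst

namespace TwoSubst
open FreeGroup

lemma expSum_endo (ρ : Subst) (i : A2) (y : FreeGroup A2) :
    Multiplicative.toAdd (expSum i (endo ρ y)) = M ρ i 0 * Multiplicative.toAdd (expSum 0 y) +
      M ρ i 1 * Multiplicative.toAdd (expSum 1 y) := by
  induction y using FreeGroup.induction_on with
  | C1 => simp
  | of j => rw [endo_of, expSum_toFG]; fin_cases j <;> simp [M, expSum]
  | inv_of j hj => simp only [_root_.map_inv, toAdd_inv, hj]; ring
  | mul a b ha hb => simp only [_root_.map_mul, toAdd_mul, ha, hb]; ring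

lemma tauA_zero : tauA (of 0) = (of 0)⁻¹ := by
  refine FreeGroup.lift_apply_of.trans ?_; simp
lemma tauA_one : tauA (of 1) = of 1 := by
  refine FreeGroup.lift_apply_of.trans ?_; simp

lemma expSum_tauA_zero (y : FreeGroup A2) :
    Multiplicative.toAdd (expSum 0 (tauA y)) = - Multiplicative.toAdd (expSum 0 y) := by
  induction y using FreeGroup.induction_on with
  | C1 => simp
  | of j =>
    fin_cases j
    · simp [tauA_zero]
    · simp [tauA_one, expSum]
  | inv_of j hj => simp only [_root_.map_inv, toAdd_inv, hj]
  | mul a b ha hb => simp only [_root_.map_mul, toAdd_mul, ha, hb]; ring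

lemma expSum_tauA_one (y : FreeGroup A2) :
    Multiplicative.toAdd (expSum 1 (tauA y)) = Multiplicative.toAdd (expSum 1 y) := by
  induction y using FreeGroup.induction_on with
  | C1 => simp
  | of j =>
    fin_cases j
    · simp [tauA_zero, expSum]
    · simp [tauA_one]
  | inv_of j hj => simp only [_root_.map_inv, toAdd_inv, hj]
  | mul a b ha hb => simp only [_root_.map_mul, toAdd_mul, ha, hb]

lemma tauA_tauA (y : FreeGroup A2) : tauA (tauA y) = y := by
  induction y using FreeGroup.induction_on with
  | C1 => simp
  | of j =>
    fin_cases j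
    · simp [tauA_zero]
    · simp [tauA_one]
  | inv_of j hj => simp only [_root_.map_inv, hj]
  | mul a b ha hb => simp only [_root_.map_mul, ha, hb]

lemma M_swapSub (ρ : Subst) (i j : A2) : M (swapSub ρ) i j = M ρ (swapA i) (swapA j) := by
  simp only [M, swapSub_apply]
  have : ∀ l : List A2, (l.map swapA).count i = l.count (swapA i) := by
    intro l
    have hinj : Function.Injective swapA := fun a b h => by
      rw [← swapA_swapA a, h, swapA_swapA]
    conv_lhs => rw [← swapA_swapA i]
    exact List.count_map_of_injective _ _ hinj _
  rw [this]

lemma recip_M {σ ρ : Subst} {φ : Monoid.End (FreeGroup A2)} (hdet : (M σ).det = 1)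
    (h : IsReciprocal σ ρ φ) :
    M ρ 0 0 = M σ 1 1 ∧ M ρ 0 1 = M σ 0 1 ∧ M ρ 1 0 = M σ 1 0 ∧ M ρ 1 1 = M σ 0 0 := by
  obtain ⟨h1, h2, h3, h4⟩ := h
  have key : ∀ x, endo ρ (tauA (endo σ x)) = tauA x := fun x => by
    rw [h4, tauA_tauA, h1]
  have e : ∀ i j : A2, - M ρ i 0 * M σ 0 j + M ρ i 1 * M σ 1 j =
      Multiplicative.toAdd (expSum i (tauA (of j))) := by
    intro i j
    rw [← key, expSum_endo, expSum_tauA_zero, expSum_tauA_one, endo_of, expSum_toFG, expSum_toFG]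
    simp [M]
  have e00 := e 0 0
  have e01 := e 0 1
  have e10 := e 1 0
  have e11 := e 1 1
  rw [expSum_tauA_zero] at e00 e01
  rw [expSum_tauA_one] at e10 e11
  simp [expSum] at e00 e01 e10 e11
  rw [Matrix.det_fin_two] at hdet
  refine ⟨?_, ?_, ?_, ?_⟩
  · linear_combination (-M ρ 0 0) * hdet - M σ 1 1 * e00 + M σ 1 0 * e01
  · linear_combination (-M ρ 0 1) * hdet - M σ 0 1 * e00 + M σ 0 0 * e01
  · linear_combination (-M ρ 1 0) * hdet - M σ 1 1 * e10 + M σ 1 0 * e11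
  · linear_combination (-M ρ 1 1) * hdet - M σ 0 1 * e10 + M σ 0 0 * e11

lemma recip_surj {σ ρ : Subst} {φ : Monoid.End (FreeGroup A2)}
    (h : IsReciprocal σ ρ φ) : Function.Surjective (endo ρ) := by
  obtain ⟨h1, h2, h3, h4⟩ := h
  intro x
  refine ⟨tauA (endo σ (tauA x)), ?_⟩
  rw [h4, tauA_tauA, h1, tauA_tauA]

lemma swap_surj {ρ : Subst} (h : Function.Surjective (endo ρ)) :
    Function.Surjective (endo (swapSub ρ)) := by
  intro y
  obtain ⟨x, hx⟩ := h (endo Esub y)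
  exact ⟨endo Esub x, by
    rw [swapSub, endo_comp, endo_comp, endo_Esub_invol, hx, endo_Esub_invol]⟩

end TwoSubst

open TwoSubst in
/-- Let `σ` be a primitive invertible substitution on `{a,b}` with
`det M_σ = 1` and reciprocal substitution `ρ = σ̄`. Then `σ` is a selfdual substitution
(`σ ~ σ̄` or `σ ~ E∘σ̄∘E`) if and only if `σ` has a selfdual hull (`X_σ = X_{σ̄}` or
`X_σ = E(X_{σ̄})`, `E` acting letterwise). -/
theorem selfdual_iff_selfdual_hull (σ ρ : Subst) (hne : NonErasing σ)
    (hprim : Primitive σ) (hdet : (M σ).det = 1)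
    (φ : Monoid.End (FreeGroup A2)) (hrecip : IsReciprocal σ ρ φ) :
    SelfDual σ ρ ↔
      (Hull σ = Hull ρ ∨ Hull σ = (fun u : ℤ → A2 => swapA ∘ u) '' Hull ρ) := by

  have hρne := hrecip.2.2.1
  have hρs := recip_surj hrecip
  have hσs : Function.Surjective (endo σ) := fun x => ⟨φ x, hrecip.2.1 x⟩
  obtain ⟨m00, m01, m10, m11⟩ := recip_M hdet hrecip
  rw [← hull_swapSub]
  have hdet2 := hdet
  rw [Matrix.det_fin_two] at hdet2
  have hoff := offdiag_pos hprim
  constructor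
  · rintro (h | h)
    · exact Or.inl (h.hull_eq hne hρne hprim)
    · exact Or.inr (Conj.hull_eq hne (swapSub_nonErasing hρne) hprim h)
  · rintro (h | h)
    · left
      apply nielsen _ σ ρ rfl hne hρne hσs hρs
      obtain ⟨lam, _, hc⟩ := cross_M hne hρne hprim hdet
        (by rw [Matrix.det_fin_two, m00, m01, m10, m11]; linarith) (by rw [m00, m11]; ring) h
      rw [m00, m10] at hc
      have hps : M σ 0 0 = M σ 1 1 := by
        have : (M σ 1 0 : ℝ) ≠ 0 := by exact_mod_cast hoff.2.ne'
        have h3 : (M σ 1 0 : ℝ) * M σ 0 0 = M σ 1 0 * M σ 1 1 := by linarith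
        exact_mod_cast mul_left_cancel₀ this h3
      ext i j
      fin_cases i <;> fin_cases j <;> simp [m00, m01, m10, m11, hps]
    · right
      apply nielsen _ σ (swapSub ρ) rfl hne (swapSub_nonErasing hρne) hσs (swap_surj hρs)
      have k00 : M (swapSub ρ) 0 0 = M σ 0 0 := by rw [M_swapSub]; simp [swapA, m11]
      have k01 : M (swapSub ρ) 0 1 = M σ 1 0 := by rw [M_swapSub]; simp [swapA, m10]
      have k10 : M (swapSub ρ) 1 0 = M σ 0 1 := by rw [M_swapSub]; simp [swapA, m01]
      have k11 : M (swapSub ρ) 1 1 = M σ 1 1 := by rw [M_swapSub]; simp [swapA, m00]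
      obtain ⟨lam, hl, hc⟩ := cross_M hne (swapSub_nonErasing hρne) hprim hdet
        (by rw [Matrix.det_fin_two, k00, k01, k10, k11]; linarith) (by rw [k00, k11]) h
      rw [k00, k10] at hc
      have hqr : M σ 1 0 = M σ 0 1 := by
        have hd : (M σ 0 0 : ℝ) * M σ 1 1 - M σ 0 1 * M σ 1 0 = 1 := by exact_mod_cast hdet2
        have hne0 : lam - (M σ 0 0 : ℝ) ≠ 0 := by
          intro h0
          have hlam : lam = M σ 0 0 := by linarith
          rw [hlam] at hl
          have : (M σ 0 1 : ℝ) * M σ 1 0 = 0 := by nlinarith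
          have h5 : M σ 0 1 * M σ 1 0 = 0 := by exact_mod_cast this
          have := mul_pos hoff.1 hoff.2
          omega
        have h3 : (lam - (M σ 0 0 : ℝ)) * M σ 1 0 = (lam - M σ 0 0) * M σ 0 1 := by linarith
        exact_mod_cast mul_left_cancel₀ hne0 h3
      ext i j
      fin_cases i <;> fin_cases j <;> simp [k00, k01, k10, k11, hqr]
end

section
/- Let σ be a primitive invertible substitution on 𝒜 = {a,b} with det M_σ = 1, with frequency α and dual frequency α*. Let (a₁, a₂, a₃, …) be the sequence of partial quotients of the continued fraction expansion α = [0; a₁, a₂, a₃, …] of the (quadratic irrational) number α. Then α = α* if and only if there exist k ≥ 1 and positive integers n₁, …, n_k forming a palindrome (i.e., n_i = n_{k+1−i} for all 1 ≤ i ≤ k) such that either (a₁ = 1 + n₁ and the tail (a₂, a₃, …) is purely periodic with period word (n₂, n₃, …, n_k, n₁), i.e., a_{1+jk+i} = p_i for all j ≥ 0 and 1 ≤ i ≤ k where (p₁,…,p_k) = (n₂,…,n_k,n₁)), or (a₁ = 1 and the tail (a₂, a₃, …) is purely periodic with period word (n₁, n₂, …, n_k), i.e., a_{1+jk+i} = n_i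 for all j ≥ 0 and 1 ≤ i ≤ k). -/
open scoped Matrix

namespace CFAux

def A (n : ℕ) : Matrix (Fin 2) (Fin 2) ℤ := !![(n : ℤ), 1; 1, 0]

def P (w : List ℕ) : Matrix (Fin 2) (Fin 2) ℤ := (w.map A).prod

noncomputable def ev (w : List ℕ) (t : ℝ) : ℝ := w.foldr (fun n s => (n : ℝ) + s⁻¹) t

theorem P_cons (n : ℕ) (w : List ℕ) : P (n :: w) = A n * P w := by simp [P]

theorem P_append (v w : List ℕ) : P (v ++ w) = P v * P w := by simp [P]

theorem A_transpose (n : ℕ) : (A n)ᵀ = A n := by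
  ext i j; fin_cases i <;> fin_cases j <;> simp [A]

theorem P_transpose (w : List ℕ) : (P w)ᵀ = P w.reverse := by
  induction w with
  | nil => simp [P]
  | cons n w ih =>
    rw [P_cons, Matrix.transpose_mul, ih, A_transpose, List.reverse_cons, P_append]
    simp [P]

theorem P_cons_entries (n : ℕ) (w : List ℕ) :
    P (n :: w) 0 0 = n * P w 0 0 + P w 1 0 ∧ P (n :: w) 0 1 = n * P w 0 1 + P w 1 1 ∧
    P (n :: w) 1 0 = P w 0 0 ∧ P (n :: w) 1 1 = P w 0 1 := by
  rw [P_cons]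
  simp [A, Matrix.mul_apply, Fin.sum_univ_two]

theorem ev_cons (n : ℕ) (w : List ℕ) (t : ℝ) : ev (n :: w) t = n + (ev w t)⁻¹ := rfl

theorem ev_gt (w : List ℕ) (hw : ∀ n ∈ w, 1 ≤ n) (t : ℝ) (ht : 1 < t) : 1 < ev w t := by
  induction w with
  | nil => simpa [ev] using ht
  | cons n w ih =>
    have h1 : 1 < ev w t := ih (fun m hm => hw m (by simp [hm]))
    have h2 : (1 : ℝ) ≤ n := by exact_mod_cast hw n (by simp)
    rw [ev_cons]
    have : 0 < (ev w t)⁻¹ := by positivity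
    linarith

theorem P_ev (w : List ℕ) (hw : ∀ n ∈ w, 1 ≤ n) (t : ℝ) (ht : 1 < t) :
    ∃ c : ℝ, 0 < c ∧ (P w 0 0 : ℝ) * t + P w 0 1 = c * ev w t ∧
      (P w 1 0 : ℝ) * t + P w 1 1 = c := by
  induction w with
  | nil => exact ⟨1, by norm_num, by simp [P, ev], by simp [P]⟩
  | cons n w ih =>
    obtain ⟨c, hc, h1, h2⟩ := ih (fun m hm => hw m (by simp [hm]))
    have h3 : 1 < ev w t := ev_gt w (fun m hm => hw m (by simp [hm])) t ht
    obtain ⟨e1, e2, e3, e4⟩ := P_cons_entries n w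
    refine ⟨c * ev w t, by positivity, ?_, ?_⟩
    · rw [e1, e2, ev_cons]
      push_cast
      have : c * ev w t * (n + (ev w t)⁻¹) = n * (c * ev w t) + c := by
        field_simp
      rw [this, ← h1, ← h2]; ring
    · rw [e3, e4, h1]

theorem P_nonneg (w : List ℕ) (hw : ∀ n ∈ w, 1 ≤ n) :
    0 ≤ P w 0 1 ∧ 0 ≤ P w 1 1 ∧ 1 ≤ P w 0 1 + P w 1 1 := by
  induction w with
  | nil => simp [P]
  | cons n w ih =>
    obtain ⟨h1, h2, h3⟩ := ih (fun m hm => hw m (by simp [hm]))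
    have hn : (1 : ℤ) ≤ n := by exact_mod_cast hw n (by simp)
    obtain ⟨e1, e2, e3, e4⟩ := P_cons_entries n w
    rw [e2, e4]
    refine ⟨by positivity, h1, by nlinarith⟩

theorem P_pos (w : List ℕ) (hw : ∀ n ∈ w, 1 ≤ n) (hne : w ≠ []) : 1 ≤ P w 0 1 := by
  cases w with
  | nil => exact absurd rfl hne
  | cons n w =>
    obtain ⟨h1, h2, h3⟩ := P_nonneg w (fun m hm => hw m (by simp [hm]))
    have hn : (1 : ℤ) ≤ n := by exact_mod_cast hw n (by simp)
    obtain ⟨e1, e2, e3, e4⟩ := P_cons_entries n w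
    rw [e2]; nlinarith

/-- symmetric decomposition -/
theorem sym_decomp (N : ℕ) : ∀ p q s : ℤ, s ≤ N → 1 ≤ s → s < p → 0 ≤ q → p * s = 1 + q ^ 2 →
    ∃ l : List ℕ, l ≠ [] ∧ (∀ n ∈ l, 1 ≤ n) ∧ P l * (P l)ᵀ = !![p, q; q, s] := by
  induction N with
  | zero => intro p q s h1 h2; exfalso; push_cast at h1; omega
  | succ N ih =>
    intro p q s hN hs hp hq h
    have hqs : s ≤ q := by
      by_contra hcon
      push Not at hcon
      nlinarith
    obtain ⟨n, hn⟩ : ∃ n : ℕ, (n : ℤ) = q / s :=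
      ⟨(q / s).toNat, Int.toNat_of_nonneg (Int.ediv_nonneg hq (by omega))⟩
    have hn1 : 1 ≤ n := by
      have : (1 : ℤ) ≤ q / s := (Int.le_ediv_iff_mul_le (by omega)).2 (by omega)
      omega
    have hdm : q = n * s + q % s := by rw [hn, mul_comm]; exact (Int.mul_ediv_add_emod q s).symm
    have hr0 : 0 ≤ q % s := Int.emod_nonneg _ (by omega)
    have hr1 : q % s < s := Int.emod_lt_of_pos _ (by omega)
    generalize q % s = q' at hdm hr0 hr1
    set p' : ℤ := p - 2 * n * q + n ^ 2 * s with hp'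
    have h' : s * p' = 1 + q' ^ 2 := by rw [hp']; subst hdm; linear_combination h
    have key : ∀ l : List ℕ, P l * (P l)ᵀ = !![s, q'; q', p'] →
        P (n :: l) * (P (n :: l))ᵀ = !![p, q; q, s] := by
      intro l hl
      rw [P_cons, Matrix.transpose_mul, A_transpose]
      have : A n * P l * ((P l)ᵀ * A n) = A n * (P l * (P l)ᵀ) * A n := by
        simp only [Matrix.mul_assoc]
      rw [this, hl]
      ext i j
      fin_cases i <;> fin_cases j <;> simp [A, Matrix.mul_apply, Fin.sum_univ_two, hp', hdm] <;> ring
    have hp'1 : 1 ≤ p' := by nlinarith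
    rcases eq_or_lt_of_le hs with hs1 | hs1
    · refine ⟨[n], by simp, by simpa using hn1, key [] ?_⟩
      have hq0 : q' = 0 := by omega
      have : p' = 1 := by rw [← hs1, hq0] at h'; linarith
      rw [this, hq0, ← hs1]
      have hP : P [] = 1 := by simp [P]
      rw [hP, Matrix.transpose_one, mul_one, Matrix.one_fin_two]
    · have hlt : p' < s := by nlinarith
      obtain ⟨l, hl0, hl1, hl2⟩ := ih s q' p' (by push_cast at hN; omega) hp'1 hlt hr0 h'
      refine ⟨n :: l, by simp, ?_, key l hl2⟩
      intro m hm
      rcases List.mem_cons.1 hm with rfl | hm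
      · exact hn1
      · exact hl1 m hm

def CF (u : ℕ → ℝ) (b : ℕ → ℕ) : Prop := ∀ i, 1 < u i ∧ u i = b i + (u (i + 1))⁻¹

theorem digit (m n : ℕ) (s t : ℝ) (hs : 1 < s) (ht : 1 < t) (h : (m : ℝ) + s⁻¹ = n + t⁻¹) :
    m = n ∧ s = t := by
  have h1 : 0 < s⁻¹ := by positivity
  have h2 : 0 < t⁻¹ := by positivity
  have h3 : s⁻¹ < 1 := inv_lt_one_of_one_lt₀ hs
  have h4 : t⁻¹ < 1 := inv_lt_one_of_one_lt₀ ht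
  have h5 : (m : ℝ) < n + 1 := by linarith
  have h6 : (n : ℝ) < m + 1 := by linarith
  have h7 : m = n := by
    have : m < n + 1 := by exact_mod_cast h5
    have : n < m + 1 := by exact_mod_cast h6
    omega
  refine ⟨h7, ?_⟩
  subst h7
  exact inv_injective (by linarith)

theorem CF.digits {u : ℕ → ℝ} {b : ℕ → ℕ} (h : CF u b) (w : List ℕ) : ∀ (m : ℕ) (t : ℝ), 1 < t →
    (∀ n ∈ w, 1 ≤ n) → u m = ev w t →
    (∀ i (hi : i < w.length), b (m + i) = w[i]) ∧ u (m + w.length) = t := by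
  induction w with
  | nil => intro m t _ _ hu; simpa [ev] using hu
  | cons n w ih =>
    intro m t ht hw hu
    have hw' : ∀ k ∈ w, 1 ≤ k := fun k hk => hw k (by simp [hk])
    rw [ev_cons, (h m).2] at hu
    obtain ⟨e1, e2⟩ := digit _ _ _ _ (h (m + 1)).1 (ev_gt w hw' t ht) hu
    obtain ⟨f1, f2⟩ := ih (m + 1) t ht hw' e2
    refine ⟨?_, ?_⟩
    · intro i hi
      cases i with
      | zero => simpa using e1
      | succ i =>
        have := f1 i (by simpa using hi)
        simp only [List.getElem_cons_succ]
        rw [← this]; congr 1; omega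
    · rw [← f2]; congr 1; simp; omega

theorem CF.periodic {u : ℕ → ℝ} {b : ℕ → ℕ} (h : CF u b) (k : ℕ) (hk : u k = u 0) :
    ∀ i, b (i + k) = b i := by
  have hu : ∀ i, u (i + k) = u i := by
    intro i
    induction i with
    | zero => simpa using hk
    | succ i ih =>
      rw [(h (i + k)).2, (h i).2] at ih
      have := (digit _ _ _ _ (h _).1 (h _).1 ih).2
      rw [← this]; congr 1; omega
  intro i
  have := hu i
  rw [(h (i + k)).2, (h i).2] at this
  exact (digit _ _ _ _ (h _).1 (h _).1 this).1

theorem CF.shift {u : ℕ → ℝ} {b : ℕ → ℕ} (h : CF u b) (k : ℕ) :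
    CF (fun i => u (i + k)) (fun i => b (i + k)) := by
  intro i
  refine ⟨(h _).1, ?_⟩
  have := (h (i + k)).2
  show u (i + k) = b (i + k) + (u (i + 1 + k))⁻¹
  rw [this]; congr 3; omega

theorem CF.one_le {u : ℕ → ℝ} {b : ℕ → ℕ} (h : CF u b) (i : ℕ) : 1 ≤ b i := by
  by_contra hc
  have h0 : b i = 0 := by omega
  have h1 := (h i).2
  have h2 : (u (i+1))⁻¹ < 1 := inv_lt_one_of_one_lt₀ (h (i+1)).1
  have h3 := (h i).1
  rw [h0] at h1; push_cast at h1; linarith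

theorem CF.two_le {u : ℕ → ℝ} {b : ℕ → ℕ} (h : CF u b) (i : ℕ) : 2 < u i * u (i + 1) := by
  have h1 := (h i).2
  have h3 := (h (i + 1)).1
  have h4 : (1 : ℝ) ≤ b i := by exact_mod_cast h.one_le i
  have : u i * u (i + 1) = b i * u (i + 1) + 1 := by
    rw [h1]; field_simp
  nlinarith

theorem CF.step {u v : ℕ → ℝ} {b : ℕ → ℕ} (h : CF u b) (h' : CF v b) (i : ℕ) :
    |u (i + 1) - v (i + 1)| = |u i - v i| * (u (i + 1) * v (i + 1)) := by
  have a1 := (h (i + 1)).1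
  have a2 := (h' (i + 1)).1
  have e : u i - v i = (v (i + 1) - u (i + 1)) / (u (i + 1) * v (i + 1)) := by
    rw [(h i).2, (h' i).2]; field_simp; ring
  rw [e, abs_div, abs_of_pos (a := u (i + 1) * v (i + 1)) (by positivity), abs_sub_comm]
  field_simp

theorem CF.unique {u v : ℕ → ℝ} {b : ℕ → ℕ} (h : CF u b) (h' : CF v b) : u 0 = v 0 := by
  by_contra hne
  have hpos : 0 < |u 0 - v 0| := abs_pos.2 (sub_ne_zero.2 hne)
  -- bounded quantity D i = |1/u - 1/v| at i+1 equals |u i - v i| ≤ 1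
  have hb : ∀ i, |u i - v i| < 1 := by
    intro i
    have a1 := (h i).2
    have a2 := (h' i).2
    have b1 : (u (i+1))⁻¹ < 1 := inv_lt_one_of_one_lt₀ (h (i+1)).1
    have b2 : (v (i+1))⁻¹ < 1 := inv_lt_one_of_one_lt₀ (h' (i+1)).1
    have c1 : 0 < (u (i+1))⁻¹ := inv_pos.2 (by linarith [(h (i+1)).1])
    have c2 : 0 < (v (i+1))⁻¹ := inv_pos.2 (by linarith [(h' (i+1)).1])
    rw [abs_lt]; constructor <;> linarith
  have hg : ∀ i, 2 ^ i * |u 0 - v 0| ≤ |u (2 * i) - v (2 * i)| := by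
    intro i
    induction i with
    | zero => simp
    | succ i ih =>
      have s1 := h.step h' (2 * i)
      have s2 := h.step h' (2 * i + 1)
      have t1 := h.two_le (2 * i + 1)
      have t2 := h'.two_le (2 * i + 1)
      rw [show 2 * (i + 1) = 2 * i + 1 + 1 by ring, s2, s1, pow_succ]
      have : 4 ≤ (u (2 * i + 1) * v (2 * i + 1)) * (u (2 * i + 1 + 1) * v (2 * i + 1 + 1)) := by
        nlinarith
      have hnn := abs_nonneg (u (2 * i) - v (2 * i))
      nlinarith
  obtain ⟨n, hn⟩ := pow_unbounded_of_one_lt (|u 0 - v 0|)⁻¹ (by norm_num : (1 : ℝ) < 2)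
  have h1 := hg n
  have h2 := hb (2 * n)
  have h3 : 1 < 2 ^ n * |u 0 - v 0| := by
    rw [inv_lt_iff_one_lt_mul₀ hpos] at hn; linarith
  linarith

theorem CF.ev_range {u : ℕ → ℝ} {b : ℕ → ℕ} (h : CF u b) (k : ℕ) : ∀ m,
    u m = ev ((List.range k).map fun i => b (m + i)) (u (m + k)) := by
  induction k with
  | zero => intro m; simp [ev]
  | succ k ih =>
    intro m
    rw [List.range_succ_eq_map, List.map_cons, List.map_map, ev_cons, (h m).2, ih (m + 1)]
    simp only [Function.comp_def, Nat.succ_eq_add_one, add_zero]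
    have e : ∀ i, m + 1 + i = m + (i + 1) := fun i => by omega
    simp only [e]

theorem irr (p q r s : ℤ) (hq : 0 < q) (hr : 0 < r) (hp : 0 ≤ p) (hs : 0 ≤ s)
    (hd : p * s - q * r = 1) (y : ℝ) (hy : r * y ^ 2 + (s - p) * y - q = 0) : Irrational y := by
  rintro ⟨z, hz⟩
  have hz' : (r : ℚ) * z ^ 2 + (s - p) * z - q = 0 := by
    rw [← hz] at hy; exact_mod_cast hy
  have hsq : (2 * r * z + (s - p)) ^ 2 = (((p + s) ^ 2 - 4 : ℤ) : ℚ) := by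
    have hd' : (p : ℚ) * s - q * r = 1 := by exact_mod_cast hd
    push_cast
    linear_combination 4 * r * hz' - 4 * hd'
  have hS : IsSquare (((p + s) ^ 2 - 4 : ℤ) : ℚ) := ⟨2 * r * z + (s - p), by rw [← hsq, sq]⟩
  rw [Rat.isSquare_intCast_iff] at hS
  obtain ⟨m, hm⟩ := hS
  have hm' : (p + s) ^ 2 - 4 = |m| * |m| := by rw [hm, abs_mul_abs_self]
  have hqr : 1 ≤ q * r := by nlinarith
  have ht : 3 ≤ p + s := by
    by_contra hc
    have : p ≤ 2 := by omega
    have : s ≤ 2 := by omega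
    interval_cases p <;> interval_cases s <;> omega
  have := abs_nonneg m
  generalize |m| = k at *
  generalize p + s = t at *
  have h1 : k < t := by nlinarith
  have h2 : t - 1 < k := by nlinarith
  omega

theorem core (p q r s : ℤ) (hq : 0 < q) (hr : 0 < r) (hp : 0 ≤ p) (hs : 0 ≤ s)
    (hd : p * s - q * r = 1) (u : ℕ → ℝ) (b : ℕ → ℕ) (h : CF u b)
    (hy : r * u 0 ^ 2 + (s - p) * u 0 - q = 0) :
    q = r ↔ ∃ k, 1 ≤ k ∧ (∀ i, b (i + k) = b i) ∧ ∀ i < k, b i = b (k - 1 - i) := by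
  have hY := (h 0).1
  constructor
  · intro hqr
    subst hqr
    have hs1 : 1 ≤ s := by
      by_contra hc
      have : s = 0 := by omega
      subst this; nlinarith
    have hsp : s < p := by
      have hqR : (0 : ℝ) < q := by exact_mod_cast hq
      have : (0 : ℝ) < (p - s) * u 0 := by
        have h1 : (p - s) * u 0 = q * ((u 0 - 1) * (u 0 + 1)) := by linear_combination -hy
        rw [h1]
        exact mul_pos hqR (mul_pos (by linarith) (by linarith))
      have : (0 : ℝ) < p - s := by
        by_contra hc; push Not at hc; nlinarith
      have : (s : ℝ) < p := by linarith
      exact_mod_cast this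
    obtain ⟨l, hl0, hl1, hl2⟩ := sym_decomp s.toNat p q s (by omega) hs1 hsp hq.le (by linarith)
    rw [P_transpose, ← P_append] at hl2
    set w := l ++ l.reverse with hw
    have hw1 : ∀ n ∈ w, 1 ≤ n := by
      intro n hn; rw [hw] at hn; simp at hn; exact hl1 n hn
    have hrev : w.reverse = w := by simp [hw]
    obtain ⟨c, hc, e1, e2⟩ := P_ev w hw1 (u 0) hY
    rw [hl2] at e1 e2
    simp at e1 e2
    have hev : u 0 = ev w (u 0) := by
      have : c * u 0 = c * ev w (u 0) := by rw [← e1, ← e2]; linarith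
      exact mul_left_cancel₀ hc.ne' this
    obtain ⟨f1, f2⟩ := h.digits w 0 (u 0) hY hw1 hev
    have hlen : 1 ≤ w.length := by
      rw [hw]
      have := List.length_pos_iff.2 hl0
      simp; omega
    refine ⟨w.length, hlen, h.periodic _ (by simpa using f2), ?_⟩
    intro i hi
    have g1 := f1 i hi
    have g2 := f1 (w.length - 1 - i) (by omega)
    rw [zero_add] at g1 g2
    rw [g1, g2, ← List.getElem_reverse (by simpa using hi)]
    simp only [hrev]
  · rintro ⟨k, hk, hper, hpal⟩
    have huk : u 0 = u k := by
      have h2 := h.shift k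
      simp only [hper] at h2
      simpa using h.unique h2
    set w := (List.range k).map fun i => b (0 + i) with hw
    have hev : u 0 = ev w (u 0) := by
      have := h.ev_range k 0
      rw [zero_add, ← huk] at this; exact this
    have hlen : w.length = k := by simp [hw]
    have hw1 : ∀ n ∈ w, 1 ≤ n := by
      intro n hn
      rw [hw] at hn
      obtain ⟨i, _, rfl⟩ := List.mem_map.1 hn
      exact h.one_le _
    have hrev : w.reverse = w := by
      apply List.ext_getElem (by simp)
      intro i h1 h2
      rw [hlen] at h2
      simp only [List.getElem_reverse, hw, List.getElem_map, List.getElem_range, List.length_map, List.length_range, zero_add]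
      exact (hpal i h2).symm
    have hne : w ≠ [] := by rintro h0; rw [h0] at hlen; simp at hlen; omega
    have hsym : P w 1 0 = P w 0 1 := by
      have := P_transpose w
      rw [hrev] at this
      exact congrFun (congrFun this 0) 1
    have hpos := P_pos w hw1 hne
    obtain ⟨c, hc, e1, e2⟩ := P_ev w hw1 (u 0) hY
    rw [← hev, ← e2, hsym] at e1
    have hirr := irr p q r s hq hr hp hs hd (u 0) hy
    generalize P w 0 1 = Q at *
    generalize P w 0 0 = R at *
    generalize P w 1 1 = S at *
    have hlin : ((Q * (s - p) - r * (S - R) : ℤ) : ℝ) * u 0 = ((Q * q - r * Q : ℤ) : ℝ) := by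
      push_cast
      linear_combination Q * hy + r * e1
    by_cases hz : Q * (s - p) - r * (S - R) = 0
    · rw [hz] at hlin
      have : Q * q - r * Q = 0 := by
        have h0 : ((Q * q - r * Q : ℤ) : ℝ) = 0 := by rw [← hlin]; simp
        exact_mod_cast h0
      have : Q * (q - r) = 0 := by linarith
      rcases mul_eq_zero.1 this with h0 | h0 <;> omega
    · exfalso
      exact (hirr.intCast_mul hz).ne_int _ hlin

theorem reindex (a b : ℕ → ℕ) (hb : ∀ i, 1 ≤ b i) (hab : ∀ i, a (2 + i) = b i) :
    (∃ k, 1 ≤ k ∧ (∀ i, b (i + k) = b i) ∧ ∀ i < k, b i = b (k - 1 - i)) ↔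
    ∃ (k : ℕ) (n : ℕ → ℕ), 1 ≤ k ∧ (∀ i, 1 ≤ i → i ≤ k → 0 < n i) ∧
      (∀ i, 1 ≤ i → i ≤ k → n i = n (k + 1 - i)) ∧
      (∀ j i, 1 ≤ i → i ≤ k → a (1 + j * k + i) = n i) := by
  constructor
  · rintro ⟨k, hk, hper, hpal⟩
    have hper' : ∀ j i, b (j * k + i) = b i := by
      intro j i
      induction j with
      | zero => simp
      | succ j ih => rw [← ih, ← hper (j * k + i)]; congr 1; ring
    refine ⟨k, fun i => b (i - 1), hk, fun i _ _ => hb _, ?_, ?_⟩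
    · intro i h1 h2
      show b (i - 1) = b (k + 1 - i - 1)
      rw [hpal (i - 1) (by omega)]; congr 1; omega
    · intro j i h1 h2
      show _ = b (i - 1)
      rw [← hper' j (i - 1), ← hab]; congr 1; omega
  · rintro ⟨k, n, hk, hpos, hpal, h⟩
    have h' : ∀ j i, i < k → b (j * k + i) = n (i + 1) := by
      intro j i hi
      rw [← hab, ← h j (i + 1) (by omega) (by omega)]; congr 1; ring
    refine ⟨k, hk, ?_, ?_⟩
    · intro i
      have e := Nat.div_add_mod i k
      have l := Nat.mod_lt i (show 0 < k by omega)
      have h1 := h' (i / k) (i % k) l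
      have h2 := h' (i / k + 1) (i % k) l
      rw [show i / k * k + i % k = i by rw [mul_comm]; exact e] at h1
      rw [show (i / k + 1) * k + i % k = i + k by
        rw [add_mul, mul_comm]; omega] at h2
      rw [h1, h2]
    · intro i hi
      have h1 := h' 0 i hi
      have h2 := h' 0 (k - 1 - i) (by omega)
      simp only [zero_mul, zero_add] at h1 h2
      rw [h1, h2, hpal (i + 1) (by omega) (by omega)]; congr 1; omega

theorem reindex' (a b : ℕ → ℕ) (h1 : a 1 = 1 + b 0) (hab : ∀ i, a (2 + i) = b (i + 1))
    (k : ℕ) (n : ℕ → ℕ) (hk : 1 ≤ k) :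
    (∀ j i, 1 ≤ i → i ≤ k → b (j * k + i - 1) = n i) ↔
    (a 1 = 1 + n 1 ∧ ∀ j i, 1 ≤ i → i ≤ k →
              a (1 + j * k + i) = if i < k then n (i + 1) else n 1) := by
  constructor
  · intro h
    refine ⟨?_, ?_⟩
    · have := h 0 1 le_rfl hk
      simp at this; omega
    · intro j i hi1 hi2
      rw [show 1 + j * k + i = 2 + (j * k + i - 1) by omega, hab]
      split_ifs with hlt
      · rw [← h j (i + 1) (by omega) (by omega)]; congr 1; omega
      · have : i = k := by omega
        subst this
        rw [← h (j + 1) 1 le_rfl hk]; congr 1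
        rw [add_mul]; omega
  · rintro ⟨ha, h⟩ j i hi1 hi2
    rcases Nat.lt_or_ge 1 i with hi | hi
    · have := h j (i - 1) (by omega) (by omega)
      rw [if_pos (by omega), show 1 + j * k + (i - 1) = 2 + (j * k + i - 2) by omega, hab] at this
      rw [show i - 1 + 1 = i by omega] at this
      rw [← this]; congr 1; omega
    · have : i = 1 := by omega
      subst this
      cases j with
      | zero => simp; omega
      | succ j =>
        have := h j k hk le_rfl
        rw [if_neg (by omega), show 1 + j * k + k = 2 + (j * k + k - 1) by omega, hab] at this
        rw [← this]; congr 1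
        rw [add_mul]; omega

end CFAux

open TwoSubst in
/-- Let `σ` be a primitive invertible substitution on two letters with
`det M_σ = 1`, frequency `α` and dual frequency `α*`. Let `a 1, a 2, …` be the partial
quotients of the continued fraction expansion `α = [0; a 1, a 2, …]`, produced by the
Gauss map iteration `x 1 = α`, `a i = ⌊1/(x i)⌋`, `x (i+1) = 1/(x i) − a i`. Then
`α = α*` if and only if there are `k ≥ 1` and positive integers `n 1, …, n k` forming a
palindrome such that either `a 1 = 1 + n 1` and the tail `(a 2, a 3, …)` is purely
periodic with period word `(n 2, …, n k, n 1)`, or `a 1 = 1` and the tail is purely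
periodic with period word `(n 1, …, n k)`. -/
theorem freq_eq_dualFreq_iff_cf (σ : Subst) (hne : NonErasing σ)
    (hprim : Primitive σ) (hinv : IsInvertible σ) (hdet : (M σ).det = 1)
    (lam α αs : ℝ)
    (hα0 : 0 < α) (hα1 : α < 1)
    (hα : (Mreal σ).mulVec ![1 - α, α] = lam • ![1 - α, α])
    (hαs0 : 0 < αs) (hαs1 : αs < 1)
    (hαs : (Mreal σ)ᵀ.mulVec ![1 - αs, αs] = lam • ![1 - αs, αs])
    (x : ℕ → ℝ) (a : ℕ → ℕ)
    (hx1 : x 1 = α)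
    (hgauss : ∀ i, 1 ≤ i → (a i : ℝ) = ⌊(x i)⁻¹⌋ ∧ x (i + 1) = (x i)⁻¹ - a i) :
    α = αs ↔
      ∃ (k : ℕ) (n : ℕ → ℕ), 1 ≤ k ∧
        (∀ i, 1 ≤ i → i ≤ k → 0 < n i) ∧
        (∀ i, 1 ≤ i → i ≤ k → n i = n (k + 1 - i)) ∧
        ((a 1 = 1 + n 1 ∧
            ∀ j i, 1 ≤ i → i ≤ k →
              a (1 + j * k + i) = if i < k then n (i + 1) else n 1) ∨
          (a 1 = 1 ∧ ∀ j i, 1 ≤ i → i ≤ k → a (1 + j * k + i) = n i)) := by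
  have hofd : (M σ).det = M σ 0 0 * M σ 1 1 - M σ 0 1 * M σ 1 0 := Matrix.det_fin_two _
  rw [hofd] at hdet
  have hnn : ∀ i j, 0 ≤ M σ i j := fun i j => by simp [M]
  -- off-diagonal entries are nonzero
  have hoff : M σ 0 1 ≠ 0 ∧ M σ 1 0 ≠ 0 := by
    obtain ⟨n, -, hpos⟩ := hprim
    constructor
    · intro h0
      have : ∀ m, (M σ ^ m) 0 1 = 0 := by
        intro m
        induction m with
        | zero => simp
        | succ m ih => rw [pow_succ, Matrix.mul_apply, Fin.sum_univ_two, ih, h0]; simp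
      have h1 := hpos 0 1
      rw [this] at h1; omega
    · intro h0
      have : ∀ m, (M σ ^ m) 1 0 = 0 := by
        intro m
        induction m with
        | zero => simp
        | succ m ih => rw [pow_succ, Matrix.mul_apply, Fin.sum_univ_two, ih, h0]; simp
      have h1 := hpos 1 0
      rw [this] at h1; omega
  have hp := hnn 0 0
  have hs := hnn 1 1
  have hq : 0 < M σ 0 1 := lt_of_le_of_ne (hnn 0 1) hoff.1.symm
  have hr : 0 < M σ 1 0 := lt_of_le_of_ne (hnn 1 0) hoff.2.symm
  have e1 := congrFun hα 0
  have e2 := congrFun hα 1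
  have e3 := congrFun hαs 0
  have e4 := congrFun hαs 1
  simp [Mreal, Matrix.mulVec, dotProduct, Fin.sum_univ_two] at e1 e2 e3 e4
  generalize M σ 0 0 = p at *
  generalize M σ 0 1 = q at *
  generalize M σ 1 0 = r at *
  generalize M σ 1 1 = s at *
  have hqR : (0 : ℝ) < q := by exact_mod_cast hq
  have hrR : (0 : ℝ) < r := by exact_mod_cast hr
  have hquad : (r : ℝ) * (1 - α) ^ 2 + (s - p) * (α * (1 - α)) - q * α ^ 2 = 0 := by
    linear_combination (1 - α) * e2 - α * e1
  have hquads : (q : ℝ) * (1 - αs) ^ 2 + (s - p) * (αs * (1 - αs)) - r * αs ^ 2 = 0 := by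
    linear_combination (1 - αs) * e4 - αs * e3
  have hsymm : α = αs ↔ q = r := by
    constructor
    · intro h
      rw [← h] at e3
      have : (q : ℝ) * α = r * α := by linarith
      have := mul_right_cancel₀ hα0.ne' this
      exact_mod_cast this
    · intro h
      subst h
      have : (q : ℝ) * (α - αs) = 0 := by
        have h5 : (q : ℝ) * (α - αs) * (1:ℝ) = 0 := by
          linear_combination (1 - αs) * e1 - (1 - α) * e3
        linarith
      rcases mul_eq_zero.1 this with h0 | h0 <;> linarith
  rw [hsymm]
  -- irrationality
  set y : ℝ := (1 - α) / α with hydef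
  have hy0 : 0 < y := div_pos (by linarith) hα0
  have hyα : α⁻¹ = 1 + y := by rw [hydef]; field_simp; ring
  have hyq : (r : ℝ) * y ^ 2 + (s - p) * y - q = 0 := by
    rw [hydef]; field_simp; linear_combination hquad
  have hyirr : Irrational y := CFAux.irr p q r s hq hr hp hs (by linarith) y hyq
  have hαirr : Irrational α := by
    have : Irrational (α⁻¹) := by rw [hyα]; simpa using hyirr.ratCast_add 1
    simpa using this.inv
  have hx : ∀ i, Irrational (x (i + 1)) ∧ 0 < x (i + 1) ∧ x (i + 1) < 1 := by
    intro i
    induction i with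
    | zero => simpa [hx1] using ⟨hαirr, hα0, hα1⟩
    | succ i ih =>
      obtain ⟨g1, g2⟩ := hgauss (i + 1) (by omega)
      have hI : Irrational (x (i + 1 + 1)) := by
        rw [g2]; exact ih.1.inv.sub_natCast _
      refine ⟨hI, ?_, ?_⟩
      · have : 0 ≤ x (i + 1 + 1) := by
          rw [g2, g1]; linarith [Int.floor_le ((x (i + 1))⁻¹)]
        exact lt_of_le_of_ne this (fun h => hI.ne_zero h.symm)
      · rw [g2, g1]; linarith [Int.lt_floor_add_one ((x (i + 1))⁻¹)]
  have hrec : ∀ i, (x (i + 1))⁻¹ = a (i + 1) + x (i + 2) := by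
    intro i
    have := (hgauss (i + 1) (by omega)).2
    rw [show i + 2 = i + 1 + 1 by ring, this]; ring
  have ha1 : ∀ i, 1 ≤ a (i + 1) := by
    intro i
    by_contra hc
    have h0 : a (i + 1) = 0 := by omega
    have h1 := hrec i
    have h2 := (one_lt_inv₀ (hx i).2.1).2 (hx i).2.2
    have h3 := (hx (i + 1)).2.2
    rw [h0] at h1; push_cast at h1
    rw [show i + 1 + 1 = i + 2 by ring] at h3
    linarith
  have hyx : y = a 1 - 1 + x 2 := by
    have := hrec 0
    simp only [zero_add] at this
    rw [hx1, hyα] at this; linarith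
  have htail : ∀ i, 1 < (x (i + 1))⁻¹ := fun i => (one_lt_inv₀ (hx i).2.1).2 (hx i).2.2
  rcases Nat.lt_or_ge 1 (a 1) with hA | hA
  · -- a 1 ≥ 2
    set b : ℕ → ℕ := fun i => if i = 0 then a 1 - 1 else a (i + 1) with hb
    set u : ℕ → ℝ := fun i => if i = 0 then y else (x (i + 1))⁻¹ with hu
    have hA' : (2 : ℝ) ≤ a 1 := by exact_mod_cast hA
    have hCF : CFAux.CF u b := by
      intro i
      cases i with
      | zero =>
        have : 0 < x 2 := (hx 1).2.1
        refine ⟨by simp [hu]; linarith, ?_⟩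
        simp [hu, hb]
        rw [hyx, Nat.cast_sub (by omega)]; simp
      | succ i =>
        refine ⟨by simpa [hu] using htail (i + 1), ?_⟩
        simpa [hu, hb] using hrec (i + 1)
    have hc := CFAux.core p q r s hq hr hp hs (by linarith) u b hCF (by simpa [hu] using hyq)
    rw [hc, CFAux.reindex (fun i => b (i - 2)) b hCF.one_le (fun i => by simp)]
    have hri := fun k n hk => CFAux.reindex' a b (by simp [hb]; omega)
      (fun i => by simp [hb, add_comm, add_left_comm]) k n hk
    constructor
    · rintro ⟨k, n, hk, h1, h2, h3⟩
      refine ⟨k, n, hk, h1, h2, Or.inl ((hri k n hk).1 ?_)⟩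
      intro j i hi1 hi2
      rw [← h3 j i hi1 hi2]; congr 1; omega
    · rintro ⟨k, n, hk, h1, h2, h3 | h3⟩
      · refine ⟨k, n, hk, h1, h2, ?_⟩
        intro j i hi1 hi2
        rw [← (hri k n hk).2 h3 j i hi1 hi2]; congr 1; omega
      · omega
  · have hA1 : a 1 = 1 := le_antisymm hA (ha1 0)
    have hyx2 : y = x 2 := by rw [hyx, hA1]; simp
    have hCF : CFAux.CF (fun i => (x (i + 2))⁻¹) (fun i => a (i + 2)) := by
      intro i
      refine ⟨htail (i + 1), ?_⟩
      simpa using hrec (i + 1)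
    have hc := CFAux.core s r q p hr hq hs hp (by linarith) _ _ hCF (by
      simp only [zero_add]
      rw [← hyx2]
      field_simp
      linear_combination -hyq)
    rw [eq_comm, hc, CFAux.reindex a _ hCF.one_le (fun i => by rw [add_comm])]
    constructor
    · rintro ⟨k, n, hk, h1, h2, h3⟩
      exact ⟨k, n, hk, h1, h2, Or.inr ⟨hA1, h3⟩⟩
    · rintro ⟨k, n, hk, h1, h2, h3 | h3⟩
      · have := h1 1 le_rfl hk
        have := h3.1
        omega
      · exact ⟨k, n, hk, h1, h2, h3.2⟩
end
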